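/- arXiv:2409.10948 — 2 statements merged into one kernel-verified Lean document; each statement's English description precedes it below -/
import Mathlib

section
/- Let τ ≥ 0, let m and l be nonnegative integers with l ≥ m+1, and let f : ℂ → ℂ be an entire function of exponential type τ such that f(z) = ∑_{j=0}^∞ a_j z^{2m+1+2j} for all z ∈ ℂ, where a_0 ≠ 0, and such that the restriction of f to [0,∞) is real-valued and absolutely integrable, i.e. ∫_0^∞ |f(x)| dx < ∞. Then for every real λ > τ, the Hankel transform evaluates exactly to a terminating expansion: ∫_0^∞ f(x) J_{2l}(λx) dx = (1/2) ∑_{j=0}^{l−m−1} a_j · (l+m+j)!/(l−m−j−1)! · (2/λ)^{2m+2j+2}. -/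
open MeasureTheory Real

/-- Bessel function of the first kind of nonnegative integer order `n`. -/
noncomputable def besselJ (n : ℕ) (x : ℝ) : ℝ :=
  ∑' k : ℕ, (-1 : ℝ) ^ k / (Nat.factorial k * Nat.factorial (n + k)) * (x / 2) ^ (n + 2 * k)

/-- `f` is an entire function of exponential type `τ`. -/
def ExpType (τ : ℝ) (f : ℂ → ℂ) : Prop :=
  Differentiable ℂ f ∧
    ∀ ε > 0, ∃ C > 0, ∀ z : ℂ, ‖f z‖ ≤ C * Real.exp ((τ + ε) * ‖z‖)

open Set Filter Topology

theorem integrableOn_pow_mul_exp_neg_mul (n : ℕ) {σ : ℝ} (hσ : 0 < σ) :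
    IntegrableOn (fun x : ℝ => x ^ n * Real.exp (-(σ * x))) (Ioi 0) := by
  have h := integrableOn_rpow_mul_exp_neg_mul_rpow (p := 1) (s := (n : ℝ)) (b := σ)
    (by linarith [n.cast_nonneg (α := ℝ)]) one_pos hσ
  refine h.congr_fun (fun x _ => ?_) measurableSet_Ioi
  simp

theorem integral_pow_mul_exp_neg_mul (n : ℕ) {σ : ℝ} (hσ : 0 < σ) :
    ∫ x in Ioi (0 : ℝ), x ^ n * Real.exp (-(σ * x)) = n.factorial / σ ^ (n + 1) := by
  have h := Real.integral_rpow_mul_exp_neg_mul_Ioi (a := (n : ℝ) + 1) (r := σ)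
    (by positivity) hσ
  rw [Real.Gamma_nat_eq_factorial] at h
  simp only [add_sub_cancel_right, Real.rpow_natCast] at h
  rw [h, show (n : ℝ) + 1 = ((n + 1 : ℕ) : ℝ) by push_cast; ring, Real.rpow_natCast,
    one_div, inv_pow]
  field_simp

/-- Cauchy's estimate for the coefficients of an entire odd power series. -/
theorem norm_coeff_mul_pow_le {f : ℂ → ℂ} {a : ℕ → ℂ} {m : ℕ} (hf : Differentiable ℂ f)
    (hexp : ∀ z : ℂ, HasSum (fun j : ℕ => a j * z ^ (2 * m + 1 + 2 * j)) (f z))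
    {R M : ℝ} (hR : 0 < R) (hM : ∀ z : ℂ, ‖z‖ = R → ‖f z‖ ≤ M) (j : ℕ) :
    ‖a j‖ * R ^ (2 * m + 1 + 2 * j) ≤ M := by
  set e : ℕ → ℕ := fun j => 2 * m + 1 + 2 * j with he
  have hinj : Function.Injective e := fun i j h => by simp only [he] at h; omega
  set c : ℕ → ℂ := Function.extend e a 0 with hc
  have hce : ∀ j, c (e j) = a j := fun j => hinj.extend_apply _ _ _
  have hsum : ∀ z : ℂ, HasSum (fun n => z ^ n * c n) (f z) := by
    intro z
    rw [← hinj.hasSum_iff]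
    · convert hexp z using 2 with j
      simp only [Function.comp, hce]
      ring
    · intro n hn
      rw [hc, Function.extend_apply' _ _ _ (by simpa using hn)]
      simp
  have hp : HasFPowerSeriesAt f (FormalMultilinearSeries.ofScalars ℂ c) 0 := by
    rw [hasFPowerSeriesAt_iff]
    refine Eventually.of_forall fun z => ?_
    simpa [FormalMultilinearSeries.coeff_ofScalars] using hsum z
  obtain ⟨r, hr⟩ := hp
  have h1 := hr.factorial_smul (y := 1) (e j)
  rw [← iteratedDeriv_eq_iteratedFDeriv] at h1
  have h2 := Complex.norm_iteratedDeriv_le_of_forall_mem_sphere_norm_le (c := 0) (e j) hR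
    hf.diffContOnCl (fun z hz => hM z (by simpa using hz))
  rw [← h1] at h2
  simp only [FormalMultilinearSeries.ofScalars_apply_eq, hce, one_pow, nsmul_eq_mul, smul_eq_mul,
    mul_one, norm_mul, Complex.norm_natCast] at h2
  have hfac : (0 : ℝ) < (e j).factorial := by positivity
  rw [mul_div_assoc, mul_le_mul_iff_right₀ hfac, le_div_iff₀ (by positivity)] at h2
  exact h2

/-- The Borel transform of an entire function of exponential type `τ` converges absolutely
outside the disc of radius `τ`. -/
theorem summable_borelTransform {f : ℂ → ℂ} {a : ℕ → ℂ} {m : ℕ} {τ : ℝ} (hτ : 0 ≤ τ)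
    (hf : ExpType τ f)
    (hexp : ∀ z : ℂ, HasSum (fun j : ℕ => a j * z ^ (2 * m + 1 + 2 * j)) (f z))
    {ρ : ℝ} (hρ : τ < ρ) :
    Summable fun j : ℕ =>
      ‖a j‖ * (2 * m + 1 + 2 * j).factorial / ρ ^ (2 * m + 1 + 2 * j + 1) := by
  obtain ⟨σ, hτσ, hσρ⟩ := exists_between hρ
  obtain ⟨C, hC, hfC⟩ := hf.2 ((σ - τ) / 2) (by linarith)
  set μ := τ + (σ - τ) / 2 with hμ
  have hσ : 0 < σ := by linarith
  have hρ0 : 0 < ρ := by linarith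
  have hbound : ∀ j : ℕ, ‖a j‖ * ((2 * m + 1 + 2 * j).factorial / σ ^ (2 * m + 1 + 2 * j + 1)) ≤
      C * (1 / (σ - μ)) := by
    intro j
    have hneg : μ - σ < 0 := by rw [hμ]; linarith
    have hexpI := integral_exp_mul_Ioi hneg 0
    have heq : 1 / (σ - μ) = ∫ x in Ioi (0 : ℝ), Real.exp ((μ - σ) * x) := by
      rw [hexpI, ← neg_sub σ μ, mul_zero, Real.exp_zero, neg_div_neg_eq]
    rw [← integral_pow_mul_exp_neg_mul _ hσ, heq, ← integral_const_mul, ← integral_const_mul]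
    refine setIntegral_mono_on ((integrableOn_pow_mul_exp_neg_mul _ hσ).const_mul _)
      ((integrableOn_exp_mul_Ioi hneg 0).const_mul _) measurableSet_Ioi fun x hx => ?_
    have h := norm_coeff_mul_pow_le hf.1 hexp (R := x) (M := C * Real.exp (μ * x)) hx
      (fun z hz => by simpa [hz] using hfC z) j
    calc _ = ‖a j‖ * x ^ (2 * m + 1 + 2 * j) * Real.exp (-(σ * x)) := by ring
      _ ≤ C * Real.exp (μ * x) * Real.exp (-(σ * x)) := by gcongr
      _ = _ := by rw [mul_assoc, ← Real.exp_add]; ring_nf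
  have hq : (σ / ρ) ^ 2 < 1 := by
    rw [sq_lt_one_iff₀ (by positivity), div_lt_one hρ0]; exact hσρ
  refine Summable.of_nonneg_of_le (fun j => by positivity) (fun j => ?_)
    ((summable_geometric_of_lt_one (sq_nonneg _) hq).mul_left
      (C * (1 / (σ - μ)) * (σ / ρ) ^ (2 * m + 2)))
  calc ‖a j‖ * (2 * m + 1 + 2 * j).factorial / ρ ^ (2 * m + 1 + 2 * j + 1)
      = ‖a j‖ * ((2 * m + 1 + 2 * j).factorial / σ ^ (2 * m + 1 + 2 * j + 1)) *
          (σ / ρ) ^ (2 * m + 1 + 2 * j + 1) := by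
        rw [div_pow]; field_simp
    _ ≤ C * (1 / (σ - μ)) * (σ / ρ) ^ (2 * m + 1 + 2 * j + 1) := by
        exact mul_le_mul_of_nonneg_right (hbound j) (by positivity)
    _ = _ := by rw [← pow_mul, mul_assoc _ (_ ^ _) (_ ^ _), ← pow_add]; ring_nf

/-- The Laplace transform along the positive half-line. -/
noncomputable def laplaceTransform (f : ℂ → ℂ) (s : ℂ) : ℂ :=
  ∫ x in Ioi (0 : ℝ), f x * Complex.exp (-(s * x))

/-- The Borel transform of `∑ a j * z ^ (2 * m + 1 + 2 * j)`. -/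
noncomputable def borelTransform (a : ℕ → ℂ) (m : ℕ) (s : ℂ) : ℂ :=
  ∑' j : ℕ, a j * (2 * m + 1 + 2 * j).factorial / s ^ (2 * m + 1 + 2 * j + 1)

theorem norm_cexp_neg_mul_le_one {s : ℂ} (hs : 0 ≤ s.re) {x : ℝ} (hx : 0 ≤ x) :
    ‖Complex.exp (-(s * x))‖ ≤ 1 := by
  rw [Complex.norm_exp]
  simpa using mul_nonneg hs hx

theorem continuousOn_laplaceTransform {f : ℂ → ℂ}
    (hint : IntegrableOn (fun x : ℝ => f x) (Ioi 0)) :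
    ContinuousOn (laplaceTransform f) {s : ℂ | 0 ≤ s.re} := by
  refine continuousOn_of_dominated (bound := fun x : ℝ => ‖f x‖) (fun s _ => ?_)
    (fun s hs => ?_) hint.norm ?_
  · exact hint.aestronglyMeasurable.mul (by fun_prop)
  · filter_upwards [ae_restrict_mem measurableSet_Ioi] with x hx
    rw [norm_mul]
    exact mul_le_of_le_one_right (norm_nonneg _)
      (norm_cexp_neg_mul_le_one hs (le_of_lt hx))
  · exact Eventually.of_forall fun x => by fun_prop

theorem differentiableOn_laplaceTransform {f : ℂ → ℂ}
    (hint : IntegrableOn (fun x : ℝ => f x) (Ioi 0)) :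
    DifferentiableOn ℂ (laplaceTransform f) {s : ℂ | 0 < s.re} := by
  intro s hs
  have hs' : 0 < s.re := hs
  have hnhds : {z : ℂ | s.re / 2 < z.re} ∈ 𝓝 s :=
    (isOpen_lt continuous_const Complex.continuous_re).mem_nhds (by simpa using hs')
  have hmeas : ∀ z : ℂ, AEStronglyMeasurable (fun x : ℝ => f x * Complex.exp (-(z * x)))
      (volume.restrict (Ioi 0)) := fun z => hint.aestronglyMeasurable.mul (by fun_prop)
  have h := hasDerivAt_integral_of_dominated_loc_of_deriv_le (μ := volume.restrict (Ioi (0 : ℝ)))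
    (F := fun (z : ℂ) (x : ℝ) => f x * Complex.exp (-(z * x)))
    (F' := fun (z : ℂ) (x : ℝ) => f x * (Complex.exp (-(z * x)) * (-x)))
    (bound := fun x : ℝ => ‖f x‖ * (2 / s.re)) hnhds (Eventually.of_forall hmeas) ?_ ?_ ?_
    (hint.norm.mul_const _) ?_
  · exact h.2.differentiableAt.differentiableWithinAt
  · refine Integrable.mono' hint.norm (hmeas s) ?_
    filter_upwards [ae_restrict_mem measurableSet_Ioi] with x hx
    rw [norm_mul]
    exact mul_le_of_le_one_right (norm_nonneg _)
      (norm_cexp_neg_mul_le_one hs'.le (le_of_lt hx))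
  · exact hint.aestronglyMeasurable.mul (by fun_prop)
  · filter_upwards [ae_restrict_mem measurableSet_Ioi] with x hx z hz
    have hx0 : (0 : ℝ) < x := hx
    have hz' : s.re / 2 < z.re := hz
    rw [norm_mul]
    gcongr
    rw [norm_mul, Complex.norm_exp, norm_neg, Complex.norm_real, Real.norm_of_nonneg hx0.le]
    have h1 : (-(z * (x : ℂ))).re ≤ -(s.re / 2 * x) := by
      simpa using mul_le_mul_of_nonneg_right hz'.le hx0.le
    have h2 : s.re / 2 * x ≤ Real.exp (s.re / 2 * x) :=
      le_trans (by linarith) (Real.add_one_le_exp _)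
    calc Real.exp (-(z * (x : ℂ))).re * x ≤ Real.exp (-(s.re / 2 * x)) * x := by gcongr
      _ = Real.exp (-(s.re / 2 * x)) * (s.re / 2 * x) * (2 / s.re) := by field_simp
      _ ≤ Real.exp (-(s.re / 2 * x)) * Real.exp (s.re / 2 * x) * (2 / s.re) := by gcongr
      _ = 2 / s.re := by rw [← Real.exp_add]; simp
  · refine Eventually.of_forall fun x z _ => ?_
    have h1 : HasDerivAt (fun z : ℂ => -(z * x)) (-(x : ℂ)) z := by
      simpa using! ((hasDerivAt_id z).mul_const (x : ℂ)).neg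
    exact (h1.cexp).const_mul _

theorem laplaceTransform_eq_borelTransform_ofReal {f : ℂ → ℂ} {a : ℕ → ℂ} {m : ℕ}
    (hexp : ∀ z : ℂ, HasSum (fun j : ℕ => a j * z ^ (2 * m + 1 + 2 * j)) (f z))
    {s : ℝ} (hs : 0 < s) (hsum : Summable fun j : ℕ =>
      ‖a j‖ * (2 * m + 1 + 2 * j).factorial / s ^ (2 * m + 1 + 2 * j + 1)) :
    laplaceTransform f s = borelTransform a m s := by
  have hcast : ∀ (j : ℕ) (x : ℝ), a j * (x : ℂ) ^ (2 * m + 1 + 2 * j) * Complex.exp (-(s * x)) =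
      a j * ((x ^ (2 * m + 1 + 2 * j) * Real.exp (-(s * x)) : ℝ) : ℂ) := fun j x => by
    push_cast; ring
  have h := hasSum_integral_of_summable_integral_norm (μ := volume.restrict (Ioi (0 : ℝ)))
    (F := fun (j : ℕ) (x : ℝ) =>
      a j * (x : ℂ) ^ (2 * m + 1 + 2 * j) * Complex.exp (-(s * x))) ?_ ?_
  · unfold laplaceTransform borelTransform
    have hfx : ∀ x : ℝ, ∑' j, a j * (x : ℂ) ^ (2 * m + 1 + 2 * j) * Complex.exp (-(s * x)) =
        f x * Complex.exp (-(s * x)) := fun x => ((hexp x).mul_right _).tsum_eq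
    simp only [hfx] at h
    rw [← h.tsum_eq]
    congr 1
    ext j
    simp only [hcast]
    rw [integral_const_mul, integral_complex_ofReal, integral_pow_mul_exp_neg_mul _ hs]
    push_cast
    ring
  · intro j
    simp only [hcast]
    exact (integrableOn_pow_mul_exp_neg_mul _ hs).ofReal.const_mul _
  · refine hsum.congr fun j => ?_
    rw [mul_div_assoc, ← integral_pow_mul_exp_neg_mul _ hs, ← integral_const_mul]
    refine setIntegral_congr_fun measurableSet_Ioi fun x hx => ?_
    have hx0 : (0 : ℝ) < x := hx
    simp only [hcast]
    rw [norm_mul, Complex.norm_real, Real.norm_of_nonneg (by positivity)]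

theorem differentiableOn_borelTransform {a : ℕ → ℂ} {m : ℕ} {ρ : ℝ} (hρ : 0 < ρ)
    (hsum : Summable fun j : ℕ =>
      ‖a j‖ * (2 * m + 1 + 2 * j).factorial / ρ ^ (2 * m + 1 + 2 * j + 1)) :
    DifferentiableOn ℂ (borelTransform a m) {s : ℂ | ρ < ‖s‖} := by
  refine Complex.differentiableOn_tsum_of_summable_norm hsum (fun j => ?_)
    (isOpen_lt continuous_const continuous_norm) fun j s hs => ?_
  · refine (differentiableOn_const _).div (by fun_prop) fun s hs => ?_
    exact pow_ne_zero _ (norm_pos_iff.1 (hρ.trans hs))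
  · have hs' : ρ < ‖s‖ := hs
    rw [norm_div, norm_mul, norm_pow, Complex.norm_natCast]
    gcongr

theorem borelTransform_neg (a : ℕ → ℂ) (m : ℕ) (s : ℂ) :
    borelTransform a m (-s) = borelTransform a m s := by
  unfold borelTransform
  congr 1
  ext j
  rw [Even.neg_pow ⟨m + j + 1, by ring⟩]

/-- The Laplace transform agrees with the Borel transform on the part of the closed right
half-plane where the latter converges. -/
theorem laplaceTransform_eq_borelTransform {f : ℂ → ℂ} {a : ℕ → ℂ} {m : ℕ} {τ : ℝ} (hτ : 0 ≤ τ)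
    (hf : ExpType τ f)
    (hexp : ∀ z : ℂ, HasSum (fun j : ℕ => a j * z ^ (2 * m + 1 + 2 * j)) (f z))
    (hint : IntegrableOn (fun x : ℝ => f x) (Ioi 0))
    {s : ℂ} (hs : 0 ≤ s.re) (hs' : τ < ‖s‖) : laplaceTransform f s = borelTransform a m s := by
  obtain ⟨ρ, hτρ, hρs⟩ := exists_between hs'
  have hρ : 0 < ρ := hτ.trans_lt hτρ
  have hB := differentiableOn_borelTransform hρ (summable_borelTransform hτ hf hexp hτρ)
  have hL := differentiableOn_laplaceTransform hint
  set S : Set ℂ := {ζ : ℂ | Real.log ρ < ζ.re} ∩ {ζ : ℂ | |ζ.im| < π / 2} with hS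
  have hSo : IsOpen S := (isOpen_lt continuous_const Complex.continuous_re).inter
    (isOpen_lt (continuous_abs.comp Complex.continuous_im) continuous_const)
  have hSc : IsPreconnected S := by
    refine (Convex.inter ?_ ?_).isPreconnected
    · exact convex_halfSpace_re_gt _
    · have : {ζ : ℂ | |ζ.im| < π / 2} = {ζ : ℂ | -(π / 2) < ζ.im} ∩ {ζ : ℂ | ζ.im < π / 2} := by
        ext ζ; simp [abs_lt]
      rw [this]
      exact (convex_halfSpace_im_gt _).inter (convex_halfSpace_im_lt _)
  have hmapB : MapsTo Complex.exp S {s : ℂ | ρ < ‖s‖} := fun ζ hζ => by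
    simpa [Complex.norm_exp] using (Real.log_lt_iff_lt_exp hρ).1 hζ.1
  have hmapL : MapsTo Complex.exp S {s : ℂ | 0 < s.re} := fun ζ hζ => by
    have hζ' : |ζ.im| < π / 2 := hζ.2
    change 0 < (Complex.exp ζ).re
    rw [Complex.exp_re]
    have := abs_lt.1 hζ'
    exact mul_pos (Real.exp_pos _) (Real.cos_pos_of_mem_Ioo ⟨by linarith, by linarith⟩)
  have hLa : AnalyticOnNhd ℂ (laplaceTransform f ∘ Complex.exp) S :=
    (hL.comp Complex.differentiable_exp.differentiableOn hmapL).analyticOnNhd hSo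
  have hBa : AnalyticOnNhd ℂ (borelTransform a m ∘ Complex.exp) S :=
    (hB.comp Complex.differentiable_exp.differentiableOn hmapB).analyticOnNhd hSo
  set x₀ : ℝ := Real.log ρ + 1
  have hx₀ : (x₀ : ℂ) ∈ S := by
    simp only [hS, mem_inter_iff, mem_ofPred_eq, Complex.ofReal_re, Complex.ofReal_im, abs_zero]
    exact ⟨by simp [x₀], by positivity⟩
  have hfreq : ∃ᶠ ζ in 𝓝[≠] (x₀ : ℂ),
      (laplaceTransform f ∘ Complex.exp) ζ = (borelTransform a m ∘ Complex.exp) ζ := by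
    have ht : Tendsto (fun x : ℝ => (x : ℂ)) (𝓝[>] x₀) (𝓝[≠] (x₀ : ℂ)) := by
      refine tendsto_nhdsWithin_iff.2
        ⟨(Complex.continuous_ofReal.tendsto x₀).mono_left nhdsWithin_le_nhds, ?_⟩
      filter_upwards [self_mem_nhdsWithin] with x hx
      simpa using (ne_of_gt hx)
    refine ht.frequently (Eventually.frequently ?_)
    filter_upwards [self_mem_nhdsWithin] with x hx
    have hx' : x₀ < x := hx
    have hρx : ρ < Real.exp x := (Real.log_lt_iff_lt_exp hρ).1 ((lt_add_one _).trans hx')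
    simp only [Function.comp, ← Complex.ofReal_exp]
    exact laplaceTransform_eq_borelTransform_ofReal hexp (Real.exp_pos x)
      (summable_borelTransform hτ hf hexp (hτρ.trans hρx))
  have heq := hLa.eqOn_of_preconnected_of_frequently_eq hBa hSc hx₀ hfreq
  have hopen : ∀ z : ℂ, 0 < z.re → ρ < ‖z‖ → laplaceTransform f z = borelTransform a m z := by
    intro z hz hz'
    have hz0 : z ≠ 0 := by rintro rfl; simp at hz
    have h := heq (x := Complex.log z) ⟨?_, ?_⟩
    · simpa [Complex.exp_log hz0] using h
    · simpa [Complex.log_re] using Real.log_lt_log hρ hz'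
    · simpa [Complex.log_im] using Complex.abs_arg_lt_pi_div_two_iff.2 (Or.inl hz)
  have ht : Tendsto (fun ε : ℝ => s + ε) (𝓝[>] (0 : ℝ)) (𝓝 s) := by
    have : Continuous fun ε : ℝ => s + ε := by fun_prop
    simpa using (this.tendsto 0).mono_left (nhdsWithin_le_nhds (s := Ioi 0))
  have hρo : IsOpen {s : ℂ | ρ < ‖s‖} := isOpen_lt continuous_const continuous_norm
  have hBs : Tendsto (fun ε : ℝ => borelTransform a m (s + ε)) (𝓝[>] (0 : ℝ))
      (𝓝 (borelTransform a m s)) :=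
    (hB.continuousOn.continuousAt (hρo.mem_nhds hρs)).tendsto.comp ht
  have hLs : Tendsto (fun ε : ℝ => laplaceTransform f (s + ε)) (𝓝[>] (0 : ℝ))
      (𝓝 (laplaceTransform f s)) := by
    refine (continuousOn_laplaceTransform hint s hs).tendsto.comp
      (tendsto_nhdsWithin_iff.2 ⟨ht, ?_⟩)
    filter_upwards [self_mem_nhdsWithin] with ε hε
    have : (0 : ℝ) < ε := hε
    simp only [Complex.add_re, Complex.ofReal_re]
    linarith
  refine tendsto_nhds_unique hLs (hBs.congr' ?_)
  filter_upwards [self_mem_nhdsWithin, ht.eventually (hρo.mem_nhds hρs)] with ε hε hε'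
  have hε0 : (0 : ℝ) < ε := hε
  refine (hopen _ ?_ hε').symm
  simp only [Complex.add_re, Complex.ofReal_re]
  linarith

theorem hasSum_intervalIntegral_mul {c g : ℝ → ℂ} {G : ℕ → ℝ → ℂ} {u : ℕ → ℝ} (α β : ℝ)
    (hc : Continuous c) (hG : ∀ j, Continuous (G j)) (hu : Summable u)
    (hGu : ∀ j t, ‖G j t‖ ≤ u j) (hg : ∀ t, HasSum (fun j => G j t) (g t)) :
    HasSum (fun j => ∫ t in α..β, c t * G j t) (∫ t in α..β, c t * g t) := by
  refine intervalIntegral.hasSum_integral_of_dominated_convergence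
    (fun j t => ‖c t‖ * u j) (fun j => (hc.mul (hG j)).aestronglyMeasurable)
    (fun j => Eventually.of_forall fun t _ => ?_) (Eventually.of_forall fun t _ => hu.mul_left _)
    ?_ (Eventually.of_forall fun t _ => (hg t).mul_left _)
  · rw [norm_mul]
    exact mul_le_mul_of_nonneg_left (hGu j t) (norm_nonneg _)
  · simp only [tsum_mul_left]
    exact (hc.norm.mul continuous_const).intervalIntegrable _ _

theorem integral_cexp_two_mul_int (p : ℤ) (U : ℝ) :
    ∫ t in (-(π / 2))..(π / 2), Complex.exp (2 * p * Complex.I * (t + U * Complex.I)) =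
      if p = 0 then (π : ℂ) else 0 := by
  split_ifs with hp
  · subst hp
    simp
  · have hc : (2 * p * Complex.I : ℂ) ≠ 0 := by simp [hp]
    simp only [mul_add, Complex.exp_add]
    rw [intervalIntegral.integral_mul_const, integral_exp_mul_complex hc]
    have : Complex.exp (2 * p * Complex.I * (π / 2 : ℝ)) =
        Complex.exp (2 * p * Complex.I * (-(π / 2) : ℝ)) := by
      rw [Complex.exp_eq_exp_iff_exists_int]
      exact ⟨p, by push_cast; ring⟩
    rw [this]
    simp

theorem integral_cexp_mul_sin_pow (l p : ℕ) :
    ∫ t in (-(π / 2))..(π / 2),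
      Complex.exp (2 * l * Complex.I * t) * Complex.sin t ^ (2 * p) =
      π * (-1) ^ l * (2 * p).choose (p + l) / 4 ^ p := by
  have hterm : ∀ t : ℝ, Complex.exp (2 * l * Complex.I * t) * Complex.sin t ^ (2 * p) =
      ∑ q ∈ Finset.range (2 * p + 1), ((-1) ^ p / 4 ^ p * (-1) ^ q * (2 * p).choose q) *
        Complex.exp (2 * ((p + l - q : ℤ) : ℂ) * Complex.I * (t + (0 : ℝ) * Complex.I)) := by
    intro t
    have hI : (Complex.I / 2) ^ (2 * p) = (-1) ^ p / 4 ^ p := by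
      rw [pow_mul, div_pow, Complex.I_sq, div_pow]; norm_num
    have hsin : Complex.sin t ^ (2 * p) = (Complex.I / 2) ^ (2 * p) *
        (-Complex.exp (-t * Complex.I) + Complex.exp (t * Complex.I)) ^ (2 * p) := by
      rw [← mul_pow, ← Even.neg_pow ⟨p, by ring⟩ (Complex.I / 2 * _), Complex.sin]
      congr 1
      ring
    rw [hsin, hI, add_pow, Finset.mul_sum, Finset.mul_sum]
    refine Finset.sum_congr rfl fun q hq => ?_
    have hq' : q ≤ 2 * p := by simpa [Nat.lt_succ_iff] using hq
    rw [neg_pow (Complex.exp _), ← Complex.exp_nat_mul, ← Complex.exp_nat_mul]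
    have he : Complex.exp (2 * ((p + l - q : ℤ) : ℂ) * Complex.I * (t + (0 : ℝ) * Complex.I)) =
        Complex.exp (2 * l * Complex.I * t) * Complex.exp (q * (-t * Complex.I)) *
          Complex.exp ((2 * p - q : ℕ) * (t * Complex.I)) := by
      rw [← Complex.exp_add, ← Complex.exp_add]
      congr 1
      push_cast [Nat.cast_sub hq']
      ring
    rw [he]
    ring
  simp only [hterm]
  rw [intervalIntegral.integral_finsetSum
    fun q _ => (by fun_prop : Continuous _).intervalIntegrable _ _]
  simp only [intervalIntegral.integral_const_mul, integral_cexp_two_mul_int]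
  rw [Finset.sum_eq_single (p + l)]
  · rw [if_pos (by push_cast; ring), pow_add]
    have : ((-1 : ℂ) ^ p) * (-1) ^ p = 1 := by rw [← mul_pow]; simp
    linear_combination ((-1) ^ l * ((2 * p).choose (p + l)) * π / 4 ^ p : ℂ) * this
  · intro q _ hq
    rw [if_neg (by omega), mul_zero]
  · intro h
    rw [Nat.choose_eq_zero_of_lt (by simpa [Nat.lt_succ_iff] using h)]
    simp

theorem intervalIntegral_eq_zero_of_odd {h : ℝ → ℂ} (hh : ∀ t, h (-t) = -h t) (b : ℝ) :
    ∫ t in (-b)..b, h t = 0 := by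
  have h1 := intervalIntegral.integral_comp_neg (a := -b) (b := b) h
  simp only [hh, intervalIntegral.integral_neg, neg_neg] at h1
  linear_combination (-1 / 2 : ℂ) * h1

/-- Bessel's integral for even orders, over a half-period. -/
theorem besselJ_even_eq_integral (l : ℕ) (y : ℝ) :
    (besselJ (2 * l) y : ℂ) = 1 / π * ∫ t in (-(π / 2))..(π / 2),
      Complex.cos (2 * l * t) * Complex.exp (Complex.I * y * Complex.sin t) := by
  have hdiff : ∫ t in (-(π / 2))..(π / 2),
      Complex.cos (2 * l * t) * Complex.exp (Complex.I * y * Complex.sin t) =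
      ∫ t in (-(π / 2))..(π / 2),
        Complex.exp (2 * l * Complex.I * t) * Complex.cos (y * Complex.sin t) := by
    rw [← sub_eq_zero, ← intervalIntegral.integral_sub
      ((by fun_prop : Continuous _).intervalIntegrable _ _)
      ((by fun_prop : Continuous _).intervalIntegrable _ _)]
    refine intervalIntegral_eq_zero_of_odd (fun t => ?_) _
    have h1 : ∀ t : ℝ, Complex.exp (Complex.I * y * Complex.sin t) =
        Complex.cos (y * Complex.sin t) + Complex.sin (y * Complex.sin t) * Complex.I := by
      intro t; rw [← Complex.exp_mul_I]; ring_nf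
    have h2 : ∀ t : ℝ, Complex.exp (2 * l * Complex.I * t) =
        Complex.cos (2 * l * t) + Complex.sin (2 * l * t) * Complex.I := by
      intro t; rw [← Complex.exp_mul_I]; ring_nf
    rw [h1, h1, h2, h2]
    simp only [Complex.ofReal_neg, Complex.sin_neg, mul_neg, Complex.cos_neg]
    ring
  rw [hdiff]
  have hπ : (π : ℂ) ≠ 0 := by exact_mod_cast pi_ne_zero
  have hterm : ∀ p : ℕ, ∫ t in (-(π / 2))..(π / 2), Complex.exp (2 * l * Complex.I * t) *
      ((-1) ^ p * (y * Complex.sin t) ^ (2 * p) / (2 * p).factorial) =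
      (-1) ^ p * y ^ (2 * p) / (2 * p).factorial *
        (π * (-1) ^ l * (2 * p).choose (p + l) / 4 ^ p) := by
    intro p
    rw [← integral_cexp_mul_sin_pow, ← intervalIntegral.integral_const_mul]
    congr 1
    ext t
    ring
  have hsum := hasSum_intervalIntegral_mul (-(π / 2)) (π / 2)
    (c := fun t : ℝ => Complex.exp (2 * l * Complex.I * t))
    (G := fun p t => (-1) ^ p * (y * Complex.sin t) ^ (2 * p) / (2 * p).factorial)
    (u := fun p => y ^ (2 * p) / (2 * p).factorial)
    (g := fun t : ℝ => Complex.cos (y * Complex.sin t)) (by fun_prop) (fun p => by fun_prop)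
    (Real.hasSum_cosh y).summable (fun p t => ?_) (fun t => Complex.hasSum_cos _)
  · simp only [hterm] at hsum
    rw [← (add_left_injective l).hasSum_iff] at hsum
    · rw [← hsum.tsum_eq, besselJ, Complex.ofReal_tsum, ← tsum_mul_left]
      congr 1
      ext k
      simp only [Function.comp]
      have hch : ((2 * (k + l)).choose (k + l + l) : ℂ) =
          (2 * (k + l)).factorial / ((2 * l + k).factorial * k.factorial) := by
        rw [Nat.cast_choose ℂ (by omega), show k + l + l = 2 * l + k by ring,
          show 2 * (k + l) - (2 * l + k) = k by omega]
      have hf0 : ((2 * (k + l)).factorial : ℂ) ≠ 0 := by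
        exact_mod_cast Nat.factorial_ne_zero _
      have h1 : ((-1 : ℂ) ^ l) * (-1) ^ l = 1 := by rw [← mul_pow]; simp
      rw [hch]
      push_cast
      rw [show 2 * l + 2 * k = 2 * (k + l) by ring, div_pow, pow_mul (2 : ℂ),
        show (2 : ℂ) ^ 2 = 4 by norm_num, pow_add (-1 : ℂ)]
      trans ((-1) ^ l * (-1) ^ l) * ((-1) ^ k / (k.factorial * (2 * l + k).factorial) *
        (y ^ (2 * (k + l)) / 4 ^ (k + l)))
      · rw [h1, one_mul]
      · field_simp
    · intro p hp
      have : p < l := by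
        by_contra h
        exact hp ⟨p - l, by simp; omega⟩
      rw [Nat.choose_eq_zero_of_lt (by omega)]
      simp
  · rw [norm_div, norm_mul, norm_pow, norm_pow, norm_mul, norm_neg, norm_one, one_pow, one_mul,
      Complex.norm_natCast, Complex.norm_real, ← Complex.ofReal_sin, Complex.norm_real, mul_pow,
      Real.norm_eq_abs, Real.norm_eq_abs, (even_two_mul p).pow_abs y]
    gcongr
    exact mul_le_of_le_one_right ((even_two_mul p).pow_nonneg y)
      (pow_le_one₀ (abs_nonneg _) (Real.abs_sin_le_one t))

/-- The Laplace variable `-iλ sin θ`. -/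
noncomputable def besselPhase (lam : ℝ) (θ : ℂ) : ℂ := -(Complex.I * lam * Complex.sin θ)

theorem besselPhase_eq (lam : ℝ) (θ : ℂ) : besselPhase lam θ =
    lam / 2 * (Complex.exp (-(Complex.I * θ)) - Complex.exp (Complex.I * θ)) := by
  rw [besselPhase, Complex.sin, show -θ * Complex.I = -(Complex.I * θ) by ring,
    show θ * Complex.I = Complex.I * θ by ring]
  linear_combination (-(lam : ℂ) / 2 * (Complex.exp (-(Complex.I * θ)) -
    Complex.exp (Complex.I * θ))) * Complex.I_sq

theorem norm_cexp_I_mul (t U : ℝ) :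
    ‖Complex.exp (Complex.I * (t + U * Complex.I))‖ = Real.exp (-U) := by
  rw [Complex.norm_exp]; simp

theorem mul_sinh_le_norm_besselPhase {lam : ℝ} (hlam : 0 ≤ lam) (t U : ℝ) :
    lam * Real.sinh U ≤ ‖besselPhase lam (t + U * Complex.I)‖ := by
  rw [besselPhase_eq, norm_mul, norm_div, Complex.norm_real, Real.norm_of_nonneg hlam,
    RCLike.norm_ofNat, Real.sinh_eq, Complex.exp_neg]
  have h := norm_sub_norm_le (Complex.exp (Complex.I * (t + U * Complex.I)))⁻¹
    (Complex.exp (Complex.I * (t + U * Complex.I)))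
  rw [norm_inv, norm_cexp_I_mul, ← Real.exp_neg, neg_neg] at h
  calc lam * ((Real.exp U - Real.exp (-U)) / 2) = lam / 2 * (Real.exp U - Real.exp (-U)) := by ring
    _ ≤ _ := by gcongr

theorem integral_cos_div_besselPhase_pow {lam U : ℝ} (hlam : 0 < lam) (hU : 0 < U)
    (l n N : ℕ) (hn : n + 1 = 2 * N) :
    ∫ t in (-(π / 2))..(π / 2), Complex.cos (2 * l * (t + U * Complex.I)) *
        (1 / besselPhase lam (t + U * Complex.I) ^ (n + 1)) =
      if N ≤ l then (π : ℂ) / 2 * (2 / (lam : ℂ)) ^ (n + 1) * ((l - N + n).choose n : ℂ)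
      else (0 : ℂ) := by
  have hlam' : (lam : ℂ) ≠ 0 := by exact_mod_cast hlam.ne'
  set w : ℝ → ℂ := fun t => Complex.exp (Complex.I * (t + U * Complex.I)) with hw
  have hw0 : ∀ t, w t ≠ 0 := fun t => Complex.exp_ne_zero _
  have hwn : ∀ t, ‖w t‖ = Real.exp (-U) := fun t => norm_cexp_I_mul t U
  have hr1 : Real.exp (-U) ^ 2 < 1 := by
    rw [sq_lt_one_iff₀ (Real.exp_pos _).le]; simpa using hU
  have hw1 : ∀ t, ‖w t ^ 2‖ < 1 := fun t => by rw [norm_pow, hwn]; exact hr1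
  have hs : ∀ t : ℝ, 1 / besselPhase lam (t + U * Complex.I) ^ (n + 1) =
      (2 / lam) ^ (n + 1) * w t ^ (n + 1) * (1 / (1 - w t ^ 2) ^ (n + 1)) := by
    intro t
    have h1 : 1 - w t ^ 2 ≠ 0 := by
      intro h
      have := hw1 t
      rw [← sub_eq_zero.1 h] at this
      simp at this
    have h2 : besselPhase lam (t + U * Complex.I) = lam * (1 - w t ^ 2) / (2 * w t) := by
      have := hw0 t
      rw [besselPhase_eq, Complex.exp_neg]
      change (lam : ℂ) / 2 * ((w t)⁻¹ - w t) = _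
      field_simp
    have := hw0 t
    rw [h2, div_pow, mul_pow, div_pow, mul_pow]
    field_simp
  simp only [hs]
  have hsum := hasSum_intervalIntegral_mul (-(π / 2)) (π / 2)
    (c := fun t : ℝ => Complex.cos (2 * l * (t + U * Complex.I)) *
      ((2 / lam) ^ (n + 1) * w t ^ (n + 1)))
    (G := fun k t => (k + n).choose n * (w t ^ 2) ^ k)
    (u := fun k => ((k + n).choose n : ℝ) * (Real.exp (-U) ^ 2) ^ k)
    (g := fun t : ℝ => 1 / (1 - w t ^ 2) ^ (n + 1)) (by fun_prop) (fun k => by fun_prop)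
    (hasSum_choose_mul_geometric_of_norm_lt_one n
      (by rwa [Real.norm_of_nonneg (sq_nonneg _)])).summable (fun k t => ?_)
    (fun t => hasSum_choose_mul_geometric_of_norm_lt_one n (hw1 t))
  · have hterm : ∀ k : ℕ, ∫ t in (-(π / 2))..(π / 2),
        Complex.cos (2 * l * (t + U * Complex.I)) * ((2 / lam) ^ (n + 1) * w t ^ (n + 1)) *
          ((k + n).choose n * (w t ^ 2) ^ k) =
        if N + k = l then (π : ℂ) / 2 * (2 / (lam : ℂ)) ^ (n + 1) * ((k + n).choose n : ℂ)
        else (0 : ℂ) := by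
      intro k
      have hpt : ∀ t : ℝ, Complex.cos (2 * l * (t + U * Complex.I)) *
          ((2 / lam) ^ (n + 1) * w t ^ (n + 1)) * ((k + n).choose n * (w t ^ 2) ^ k) =
          (2 / lam) ^ (n + 1) * (k + n).choose n / 2 *
            (Complex.exp (2 * ((N + k + l : ℤ) : ℂ) * Complex.I * (t + U * Complex.I)) +
            Complex.exp (2 * ((N + k - l : ℤ) : ℂ) * Complex.I * (t + U * Complex.I))) := by
        intro t
        have hwp : w t ^ (n + 1) * (w t ^ 2) ^ k =
            Complex.exp (2 * (N + k) * Complex.I * (t + U * Complex.I)) := by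
          rw [hn, ← pow_mul, ← pow_add, hw, ← Complex.exp_nat_mul]
          congr 1
          push_cast
          ring
        have h1 : Complex.exp (2 * ((N + k + l : ℤ) : ℂ) * Complex.I * (t + U * Complex.I)) =
            Complex.exp (2 * (N + k) * Complex.I * (t + U * Complex.I)) *
              Complex.exp (2 * l * (t + U * Complex.I) * Complex.I) := by
          rw [← Complex.exp_add]; congr 1; push_cast; ring
        have h2 : Complex.exp (2 * ((N + k - l : ℤ) : ℂ) * Complex.I * (t + U * Complex.I)) =
            Complex.exp (2 * (N + k) * Complex.I * (t + U * Complex.I)) *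
              Complex.exp (-(2 * l * (t + U * Complex.I)) * Complex.I) := by
          rw [← Complex.exp_add]; congr 1; push_cast; ring
        rw [h1, h2, ← hwp, Complex.cos]
        ring
      simp only [hpt]
      rw [intervalIntegral.integral_const_mul, intervalIntegral.integral_add
        ((by fun_prop : Continuous _).intervalIntegrable _ _)
        ((by fun_prop : Continuous _).intervalIntegrable _ _),
        integral_cexp_two_mul_int, integral_cexp_two_mul_int, if_neg (by omega)]
      by_cases h : N + k = l
      · rw [if_pos (by omega), if_pos h]
        ring
      · rw [if_neg (by omega), if_neg h]
        ring
    simp only [hterm] at hsum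
    simp only [← mul_assoc] at hsum ⊢
    rw [← hsum.tsum_eq]
    split_ifs with hNl
    · rw [tsum_eq_single (l - N) fun k hk => if_neg (by omega), if_pos (by omega)]
    · exact (tsum_congr fun k => if_neg (by omega)).trans tsum_zero
  · rw [norm_mul, norm_pow, norm_pow, hwn, Complex.norm_natCast]

theorem integral_cos_mul_borelTransform {a : ℕ → ℂ} {m l : ℕ} {lam U ρ : ℝ}
    (hlam : 0 < lam) (hU : 0 < U) (hρ : 0 < ρ) (hρU : ρ ≤ lam * Real.sinh U)
    (hsum : Summable fun j : ℕ =>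
      ‖a j‖ * (2 * m + 1 + 2 * j).factorial / ρ ^ (2 * m + 1 + 2 * j + 1)) :
    ∫ t in (-(π / 2))..(π / 2), Complex.cos (2 * l * (t + U * Complex.I)) *
        borelTransform a m (besselPhase lam (t + U * Complex.I)) =
      π * ((1 / 2) * ∑ j ∈ Finset.range (l - m),
        a j * ((Nat.factorial (l + m + j) : ℂ) / (Nat.factorial (l - m - j - 1) : ℂ))
          * (2 / (lam : ℂ)) ^ (2 * m + 2 * j + 2)) := by
  have hρs : ∀ t : ℝ, ρ ≤ ‖besselPhase lam (t + U * Complex.I)‖ := fun t =>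
    hρU.trans (mul_sinh_le_norm_besselPhase hlam.le t U)
  have hs0 : ∀ t : ℝ, besselPhase lam (t + U * Complex.I) ≠ 0 := fun t =>
    norm_pos_iff.1 (hρ.trans_le (hρs t))
  have hscont : Continuous fun t : ℝ => besselPhase lam (t + U * Complex.I) := by
    unfold besselPhase; fun_prop
  have hbound : ∀ (j : ℕ) (t : ℝ), ‖a j * (2 * m + 1 + 2 * j).factorial /
      besselPhase lam (t + U * Complex.I) ^ (2 * m + 1 + 2 * j + 1)‖ ≤
      ‖a j‖ * (2 * m + 1 + 2 * j).factorial / ρ ^ (2 * m + 1 + 2 * j + 1) := by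
    intro j t
    rw [norm_div, norm_mul, norm_pow, Complex.norm_natCast]
    have := hρs t
    gcongr
  have h := hasSum_intervalIntegral_mul (-(π / 2)) (π / 2)
    (c := fun t : ℝ => Complex.cos (2 * l * (t + U * Complex.I)))
    (G := fun (j : ℕ) (t : ℝ) => a j * (2 * m + 1 + 2 * j).factorial /
      besselPhase lam (t + U * Complex.I) ^ (2 * m + 1 + 2 * j + 1))
    (g := fun t : ℝ => borelTransform a m (besselPhase lam (t + U * Complex.I)))
    (by fun_prop) (fun j => continuous_const.div (hscont.pow _) fun t => pow_ne_zero _ (hs0 t))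
    hsum hbound (fun t => (Summable.of_norm_bounded hsum fun j => hbound j t).hasSum)
  have hterm : ∀ j : ℕ, ∫ t in (-(π / 2))..(π / 2), Complex.cos (2 * l * (t + U * Complex.I)) *
      (a j * (2 * m + 1 + 2 * j).factorial /
        besselPhase lam (t + U * Complex.I) ^ (2 * m + 1 + 2 * j + 1)) =
      a j * (2 * m + 1 + 2 * j).factorial * if m + j + 1 ≤ l then
        (π : ℂ) / 2 * (2 / (lam : ℂ)) ^ (2 * m + 1 + 2 * j + 1) *
          ((l - (m + j + 1) + (2 * m + 1 + 2 * j)).choose (2 * m + 1 + 2 * j) : ℂ)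
        else (0 : ℂ) := by
    intro j
    rw [← integral_cos_div_besselPhase_pow hlam hU l _ (m + j + 1) (by ring),
      ← intervalIntegral.integral_const_mul]
    congr 1
    ext t
    ring
  simp only [hterm] at h
  rw [← h.tsum_eq, tsum_eq_sum (s := Finset.range (l - m)), ← mul_assoc, Finset.mul_sum]
  · refine Finset.sum_congr rfl fun j hj => ?_
    have hj' : j < l - m := Finset.mem_range.1 hj
    rw [if_pos (by omega),
      show l - (m + j + 1) + (2 * m + 1 + 2 * j) = l + m + j by omega,
      Nat.cast_choose ℂ (by omega),
      show l + m + j - (2 * m + 1 + 2 * j) = l - m - j - 1 by omega,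
      show 2 * m + 1 + 2 * j + 1 = 2 * m + 2 * j + 2 by ring]
    have hf0 : ((2 * m + 1 + 2 * j).factorial : ℂ) ≠ 0 := by
      exact_mod_cast Nat.factorial_ne_zero _
    field_simp
  · intro j hj
    rw [Finset.mem_range] at hj
    rw [if_neg (by omega), mul_zero]

theorem re_besselPhase (lam t u : ℝ) :
    (besselPhase lam (t + u * Complex.I)).re = lam * (Real.cos t * Real.sinh u) := by
  rw [besselPhase, Complex.sin_add_mul_I, ← Complex.ofReal_sin, ← Complex.ofReal_cos,
    ← Complex.ofReal_sinh, ← Complex.ofReal_cosh]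
  simp [-Complex.ofReal_cos, -Complex.ofReal_sin, -Complex.ofReal_sinh, -Complex.ofReal_cosh]

/-- Shifting Bessel's contour upwards: the contributions of the vertical sides cancel. -/
theorem integral_cos_mul_laplaceTransform_shift {f : ℂ → ℂ} {lam U : ℝ} (hlam : 0 < lam)
    (hU : 0 < U) (l : ℕ) (hint : IntegrableOn (fun x : ℝ => f x) (Ioi 0))
    (hsymm : ∀ s : ℂ, s.re = 0 → lam ≤ ‖s‖ → laplaceTransform f (-s) = laplaceTransform f s) :
    ∫ t in (-(π / 2))..(π / 2), Complex.cos (2 * l * t) *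
        laplaceTransform f (besselPhase lam t) =
      ∫ t in (-(π / 2))..(π / 2), Complex.cos (2 * l * (t + U * Complex.I)) *
        laplaceTransform f (besselPhase lam (t + U * Complex.I)) := by
  have hπ : -(π / 2) ≤ π / 2 := by linarith [pi_pos]
  have hphase : Continuous (besselPhase lam) := by unfold besselPhase; fun_prop
  have hphased : Differentiable ℂ (besselPhase lam) := by unfold besselPhase; fun_prop
  have hre : ∀ θ : ℂ, (besselPhase lam θ).re = lam * (Real.cos θ.re * Real.sinh θ.im) := by
    intro θ
    conv_lhs => rw [← Complex.re_add_im θ]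
    exact re_besselPhase lam θ.re θ.im
  have hrect := Complex.integral_boundary_rect_eq_zero_of_continuousOn_of_differentiableOn
    (fun θ => Complex.cos (2 * l * θ) * laplaceTransform f (besselPhase lam θ))
    ((-(π / 2) : ℝ) : ℂ) ((π / 2 : ℝ) + U * Complex.I) ?_ ?_
  · simp only [Complex.ofReal_re, Complex.ofReal_im, Complex.add_re, Complex.add_im,
      Complex.mul_re, Complex.mul_im, Complex.I_re, Complex.I_im, mul_zero, mul_one, sub_self,
      add_zero, zero_add, zero_mul, Complex.ofReal_zero] at hrect
    have hside : ∀ y : ℝ,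
        Complex.cos (2 * l * ((π / 2 : ℝ) + y * Complex.I)) *
          laplaceTransform f (besselPhase lam ((π / 2 : ℝ) + y * Complex.I)) =
        Complex.cos (2 * l * ((-(π / 2) : ℝ) + y * Complex.I)) *
          laplaceTransform f (besselPhase lam ((-(π / 2) : ℝ) + y * Complex.I)) := by
      intro y
      have h1 : Complex.cos (2 * l * ((π / 2 : ℝ) + y * Complex.I)) =
          Complex.cos (2 * l * ((-(π / 2) : ℝ) + y * Complex.I)) := by
        rw [← Complex.cos_add_nat_mul_two_pi (2 * l * ((-(π / 2) : ℝ) + y * Complex.I)) l]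
        congr 1
        push_cast
        ring
      have h2 : besselPhase lam ((-(π / 2) : ℝ) + y * Complex.I) =
          Complex.I * lam * Complex.cosh y := by
        rw [besselPhase, Complex.sin_add_mul_I, ← Complex.ofReal_sin, ← Complex.ofReal_cos]
        simp
      have h3 : besselPhase lam ((π / 2 : ℝ) + y * Complex.I) =
          -(Complex.I * lam * Complex.cosh y) := by
        rw [besselPhase, Complex.sin_add_mul_I, ← Complex.ofReal_sin, ← Complex.ofReal_cos]
        simp
      rw [h1, h2, h3, hsymm]
      · rw [← Complex.ofReal_cosh]; simp
      · rw [← Complex.ofReal_cosh, norm_mul, norm_mul, Complex.norm_I, Complex.norm_real,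
          Complex.norm_real, Real.norm_of_nonneg hlam.le,
          Real.norm_of_nonneg (Real.cosh_pos y).le, one_mul]
        exact le_mul_of_one_le_right hlam.le (Real.one_le_cosh y)
    simp only [hside, add_sub_cancel_right] at hrect
    exact sub_eq_zero.1 hrect
  · simp only [Complex.ofReal_re, Complex.ofReal_im, Complex.add_re, Complex.add_im,
      Complex.mul_re, Complex.mul_im, Complex.I_re, Complex.I_im, mul_zero, mul_one, sub_self,
      add_zero, zero_add]
    refine (by fun_prop : Continuous _).continuousOn.mul
      ((continuousOn_laplaceTransform hint).comp hphase.continuousOn ?_)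
    rintro θ ⟨hθ1, hθ2⟩
    rw [uIcc_of_le hπ] at hθ1
    rw [uIcc_of_le hU.le] at hθ2
    change 0 ≤ (besselPhase lam θ).re
    rw [hre]
    exact mul_nonneg hlam.le (mul_nonneg (Real.cos_nonneg_of_mem_Icc hθ1)
      (Real.sinh_nonneg_iff.2 hθ2.1))
  · simp only [Complex.ofReal_re, Complex.ofReal_im, Complex.add_re, Complex.add_im,
      Complex.mul_re, Complex.mul_im, Complex.I_re, Complex.I_im, mul_zero, mul_one, sub_self,
      add_zero, zero_add, min_eq_left hπ, max_eq_right hπ, min_eq_left hU.le,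
      max_eq_right hU.le]
    refine (by fun_prop : Differentiable ℂ _).differentiableOn.mul
      ((differentiableOn_laplaceTransform hint).comp hphased.differentiableOn ?_)
    rintro θ ⟨hθ1, hθ2⟩
    change 0 < (besselPhase lam θ).re
    rw [hre]
    exact mul_pos hlam (mul_pos (Real.cos_pos_of_mem_Ioo hθ1) (Real.sinh_pos_iff.2 hθ2.1))

theorem integral_mul_besselJ_even {f : ℂ → ℂ} (l : ℕ) (lam : ℝ)
    (hint : IntegrableOn (fun x : ℝ => f x) (Ioi 0)) :
    ∫ x in Ioi (0 : ℝ), f x * (besselJ (2 * l) (lam * x) : ℂ) =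
      1 / π * ∫ t in (-(π / 2))..(π / 2), Complex.cos (2 * l * t) *
        laplaceTransform f (besselPhase lam t) := by
  have hI : Integrable (Function.uncurry fun (t x : ℝ) =>
      (Complex.cos (2 * l * t) * Complex.exp (Complex.I * (lam * x : ℝ) * Complex.sin t)) * f x)
      ((volume.restrict (uIoc (-(π / 2)) (π / 2))).prod (volume.restrict (Ioi 0))) := by
    have : IsFiniteMeasure (volume.restrict (uIoc (-(π / 2)) (π / 2))) := by
      unfold uIoc; infer_instance
    have h2 := Integrable.comp_snd hint (volume.restrict (uIoc (-(π / 2)) (π / 2)))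
    refine h2.bdd_mul (c := 1)
      (f := fun q : ℝ × ℝ => Complex.cos (2 * l * q.1) *
        Complex.exp (Complex.I * (lam * q.2 : ℝ) * Complex.sin q.1))
      (by fun_prop : Continuous _).aestronglyMeasurable (Eventually.of_forall fun q => ?_)
    have h3 : Complex.I * (lam * q.2 : ℝ) * Complex.sin q.1 =
        ((lam * q.2 * Real.sin q.1 : ℝ) : ℂ) * Complex.I := by push_cast; ring
    have h4 : Complex.cos (2 * l * q.1) = ((Real.cos (2 * l * q.1) : ℝ) : ℂ) := by push_cast; rfl
    rw [h3, h4, norm_mul, Complex.norm_exp_ofReal_mul_I, mul_one, Complex.norm_real]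
    exact Real.abs_cos_le_one _
  have hswap := intervalIntegral_integral_swap hI
  have hL : ∀ t : ℝ, ∫ x in Ioi (0 : ℝ), (Complex.cos (2 * l * t) *
      Complex.exp (Complex.I * (lam * x : ℝ) * Complex.sin t)) * f x =
      Complex.cos (2 * l * t) * laplaceTransform f (besselPhase lam t) := by
    intro t
    rw [laplaceTransform, ← integral_const_mul]
    congr 1
    ext x
    rw [besselPhase, show -(-(Complex.I * lam * Complex.sin t) * (x : ℂ)) =
      Complex.I * (lam * x : ℝ) * Complex.sin t by push_cast; ring]
    ring
  simp only [hL] at hswap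
  rw [hswap, ← integral_const_mul]
  congr 1
  ext x
  rw [besselJ_even_eq_integral, intervalIntegral.integral_mul_const]
  ring

theorem hankel_terminating_even_order
    (τ : ℝ) (hτ : 0 ≤ τ) (m l : ℕ) (hl : m + 1 ≤ l)
    (f : ℂ → ℂ) (a : ℕ → ℂ) (ha : a 0 ≠ 0)
    (hf : ExpType τ f)
    (hexp : ∀ z : ℂ, HasSum (fun j : ℕ => a j * z ^ (2 * m + 1 + 2 * j)) (f z))
    (hreal : ∀ x : ℝ, 0 ≤ x → (f x).im = 0)
    (hint : IntegrableOn (fun x : ℝ => f x) (Set.Ioi 0)) :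
    ∀ lam : ℝ, τ < lam →
      ∫ x in Set.Ioi (0 : ℝ), f x * (besselJ (2 * l) (lam * x) : ℂ)
        = (1 / 2) * ∑ j ∈ Finset.range (l - m),
            a j * ((Nat.factorial (l + m + j) : ℂ) / (Nat.factorial (l - m - j - 1) : ℂ))
              * (2 / (lam : ℂ)) ^ (2 * m + 2 * j + 2) := by
  intro lam hτlam
  have hlam : 0 < lam := hτ.trans_lt hτlam
  have hπ : (π : ℂ) ≠ 0 := by exact_mod_cast pi_ne_zero
  have hsymm : ∀ s : ℂ, s.re = 0 → lam ≤ ‖s‖ →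
      laplaceTransform f (-s) = laplaceTransform f s := by
    intro s hs hs'
    rw [laplaceTransform_eq_borelTransform hτ hf hexp hint (by simp [hs])
        (by rw [norm_neg]; exact hτlam.trans_le hs'),
      laplaceTransform_eq_borelTransform hτ hf hexp hint hs.ge (hτlam.trans_le hs'),
      borelTransform_neg]
  have hsinh : lam * Real.sinh (Real.arsinh 1) = lam := by simp
  have hU : 0 < Real.arsinh 1 := Real.arsinh_pos_iff.2 one_pos
  rw [integral_mul_besselJ_even l lam hint,
    integral_cos_mul_laplaceTransform_shift hlam hU l hint hsymm]
  have hcongr : ∫ t in (-(π / 2))..(π / 2),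
      Complex.cos (2 * l * (t + Real.arsinh 1 * Complex.I)) *
        laplaceTransform f (besselPhase lam (t + Real.arsinh 1 * Complex.I)) =
      ∫ t in (-(π / 2))..(π / 2), Complex.cos (2 * l * (t + Real.arsinh 1 * Complex.I)) *
        borelTransform a m (besselPhase lam (t + Real.arsinh 1 * Complex.I)) := by
    refine intervalIntegral.integral_congr fun t ht => ?_
    rw [uIcc_of_le (by linarith [pi_pos])] at ht
    have hnorm := mul_sinh_le_norm_besselPhase hlam.le t (Real.arsinh 1)
    rw [hsinh] at hnorm
    rw [laplaceTransform_eq_borelTransform hτ hf hexp hint _ (hτlam.trans_le hnorm)]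
    rw [re_besselPhase]
    exact mul_nonneg hlam.le (mul_nonneg (Real.cos_nonneg_of_mem_Icc ht)
      (Real.sinh_nonneg_iff.2 hU.le))
  rw [hcongr, integral_cos_mul_borelTransform hlam hU hlam hsinh.ge
    (summable_borelTransform hτ hf hexp hτlam)]
  field_simp
end

section
/- Let M ≥ 1 be an integer, let α_k, β_k > 0 for k = 1,…,M, let m and l be nonnegative integers with l ≥ m+1, and suppose ∑_{k=1}^M α_k > m + (1/2)(M + 3/2) and λ ≥ π·∑_{k=1}^M β_k. Then ∫_0^∞ x^{2m+1}·J_{2l}(λx)·g_M(x) dx = (1/2) ∑_{s=0}^{l−m−1} (a_s^{(M)}/(2s)!) · (l+m+s)!/(l−m−s−1)! · (2/λ)^{2(m+s+1)}. -/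
open MeasureTheory Real

/-- The product of reciprocal Gamma functions `∏_{k<M} 1/(Γ(α k + β k x) Γ(α k - β k x))`.
(Mathlib's `Real.Gamma` vanishes at nonpositive integers, so the inverse is the entire
reciprocal Gamma function.) -/
noncomputable def gammaProd (M : ℕ) (α β : ℕ → ℝ) (x : ℝ) : ℝ :=
  ∏ k ∈ Finset.range M, (Real.Gamma (α k + β k * x) * Real.Gamma (α k - β k * x))⁻¹

/-- The entire function `∑ (-y)^k / (k! (n+k)!)`, in terms of which
`J_n(x) = (x/2)^n * besselAux n (x²/4)`. -/
noncomputable def besselAux (n : ℕ) (y : ℝ) : ℝ :=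
  ∑' k : ℕ, (-1 : ℝ) ^ k / (Nat.factorial k * Nat.factorial (n + k)) * y ^ k

theorem norm_besselAux_term_le (n k : ℕ) {y R : ℝ} (hy : |y| ≤ R) :
    ‖(-1 : ℝ) ^ k / (Nat.factorial k * Nat.factorial (n + k)) * y ^ k‖
      ≤ R ^ k / (Nat.factorial k : ℝ) := by
  have hR : 0 ≤ R := (abs_nonneg y).trans hy
  have h1 : (1 : ℝ) ≤ Nat.factorial (n + k) := by exact_mod_cast Nat.factorial_pos _
  have h2 : (0 : ℝ) < Nat.factorial k := by exact_mod_cast Nat.factorial_pos _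
  rw [norm_mul, norm_div, norm_pow, norm_pow, norm_neg, norm_one, one_pow, norm_mul,
    Real.norm_natCast, Real.norm_natCast, Real.norm_eq_abs, one_div_mul_eq_div]
  gcongr
  nlinarith

theorem summable_besselAux (n : ℕ) (y : ℝ) :
    Summable fun k : ℕ => (-1 : ℝ) ^ k / (Nat.factorial k * Nat.factorial (n + k)) * y ^ k :=
  Summable.of_norm_bounded (Real.summable_pow_div_factorial |y|)
    fun k => norm_besselAux_term_le n k le_rfl

theorem besselAux_term_succ (n k : ℕ) (y : ℝ) :
    (-1 : ℝ) ^ (k + 1) / (Nat.factorial (k + 1) * Nat.factorial (n + (k + 1))) *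
        (((k + 1 : ℕ) : ℝ) * y ^ k)
      = -((-1 : ℝ) ^ k / (Nat.factorial k * Nat.factorial (n + 1 + k)) * y ^ k) := by
  have h2 : (Nat.factorial k : ℝ) ≠ 0 := by exact_mod_cast Nat.factorial_ne_zero _
  have h3 : (Nat.factorial (n + 1 + k) : ℝ) ≠ 0 := by exact_mod_cast Nat.factorial_ne_zero _
  rw [show n + (k + 1) = n + 1 + k by ring, Nat.factorial_succ k, pow_succ]
  push_cast
  have h4 : (k : ℝ) + 1 ≠ 0 := by positivity
  field_simp

theorem hasDerivAt_besselAux (n : ℕ) (y : ℝ) :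
    HasDerivAt (besselAux n) (-besselAux (n + 1) y) y := by
  set R := |y| + 1
  have key : HasDerivAt (besselAux n) (∑' k : ℕ, (-1 : ℝ) ^ k /
      (Nat.factorial k * Nat.factorial (n + k)) * ((k : ℝ) * y ^ (k - 1))) y := by
    have hu : Summable fun k : ℕ =>
        if k = 0 then 0 else R ^ (k - 1) / (Nat.factorial (k - 1) : ℝ) := by
      rw [← summable_nat_add_iff 1]
      simpa using Real.summable_pow_div_factorial R
    have hd : ∀ (k : ℕ), ∀ z ∈ Metric.ball (0 : ℝ) R, HasDerivAt
        (fun z => (-1 : ℝ) ^ k / (Nat.factorial k * Nat.factorial (n + k)) * z ^ k)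
        ((-1 : ℝ) ^ k / (Nat.factorial k * Nat.factorial (n + k)) * ((k : ℝ) * z ^ (k - 1))) z :=
      fun k z _ => (hasDerivAt_pow k z).const_mul _
    have hb : ∀ (k : ℕ), ∀ z ∈ Metric.ball (0 : ℝ) R,
        ‖(-1 : ℝ) ^ k / (Nat.factorial k * Nat.factorial (n + k)) * ((k : ℝ) * z ^ (k - 1))‖
          ≤ if k = 0 then 0 else R ^ (k - 1) / (Nat.factorial (k - 1) : ℝ) := by
      intro k z hz
      rcases k with _ | k
      · simp
      · rw [Nat.add_sub_cancel, besselAux_term_succ, norm_neg, if_neg (Nat.succ_ne_zero k)]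
        exact norm_besselAux_term_le (n + 1) k (by simpa using (Metric.mem_ball.1 hz).le)
    exact hasDerivAt_tsum_of_isPreconnected hu Metric.isOpen_ball
      (convex_ball _ _).isPreconnected hd hb (Metric.mem_ball_self (by positivity))
      (summable_besselAux n 0) (by simp [R])
  convert key using 1
  have hs := (summable_besselAux (n + 1) y).neg
  rw [Summable.tsum_eq_zero_add, besselAux, ← tsum_neg]
  · simp only [Nat.add_sub_cancel, besselAux_term_succ]
    simp
  · rw [← summable_nat_add_iff 1]
    simpa only [Nat.add_sub_cancel, besselAux_term_succ] using hs

theorem besselAux_eq (n : ℕ) (y : ℝ) :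
    besselAux n y = (n + 1) * besselAux (n + 1) y - y * besselAux (n + 2) y := by
  have h0 := summable_besselAux n y
  have h1 := summable_besselAux (n + 1) y
  have h2 := summable_besselAux (n + 2) y
  unfold besselAux
  rw [h0.tsum_eq_zero_add, h1.tsum_eq_zero_add, mul_add, ← tsum_mul_left, ← tsum_mul_left,
    add_sub_assoc, ← Summable.tsum_sub (((summable_nat_add_iff 1).2 h1).mul_left _) (h2.mul_left _)]
  have hf : ∀ j : ℕ, (Nat.factorial j : ℝ) ≠ 0 := fun j => by
    exact_mod_cast Nat.factorial_ne_zero _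
  congr 1
  · have := hf n
    simp [Nat.factorial_succ]
    field_simp
  · refine tsum_congr fun k => ?_
    have := hf k
    have := hf (n + (k + 1))
    rw [show n + 1 + (k + 1) = n + (k + 1) + 1 by ring, show n + 2 + k = n + (k + 1) + 1 by ring,
      Nat.factorial_succ (n + (k + 1)), Nat.factorial_succ k]
    push_cast
    have : (n : ℝ) + (k + 1) + 1 ≠ 0 := by positivity
    have : (k : ℝ) + 1 ≠ 0 := by positivity
    field_simp
    ring

theorem besselJ_eq_besselAux (n : ℕ) (x : ℝ) :
    besselJ n x = (x / 2) ^ n * besselAux n (x ^ 2 / 4) := by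
  unfold besselJ besselAux
  rw [← tsum_mul_left]
  refine tsum_congr fun k => ?_
  rw [pow_add, pow_mul, div_pow x 2 2]
  norm_num
  ring

theorem mul_besselJ_add (n : ℕ) (x : ℝ) :
    x * (besselJ n x + besselJ (n + 2) x) = 2 * (n + 1) * besselJ (n + 1) x := by
  rw [besselJ_eq_besselAux, besselJ_eq_besselAux, besselJ_eq_besselAux, besselAux_eq n]
  ring

theorem hasDerivAt_besselAux_comp (n : ℕ) (x : ℝ) :
    HasDerivAt (fun x => besselAux n (x ^ 2 / 4)) (-(x / 2) * besselAux (n + 1) (x ^ 2 / 4)) x := by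
  have := (hasDerivAt_besselAux n (x ^ 2 / 4)).comp x ((hasDerivAt_pow 2 x).div_const 4)
  refine this.congr_deriv ?_
  push_cast
  ring

theorem hasDerivAt_besselJ_zero (x : ℝ) : HasDerivAt (besselJ 0) (-besselJ 1 x) x := by
  have h : besselJ 0 = fun x => besselAux 0 (x ^ 2 / 4) := by
    ext x; simp [besselJ_eq_besselAux]
  rw [h, besselJ_eq_besselAux]
  convert hasDerivAt_besselAux_comp 0 x using 1
  ring

theorem hasDerivAt_besselJ_succ (n : ℕ) (x : ℝ) :
    HasDerivAt (besselJ (n + 1)) ((besselJ n x - besselJ (n + 2) x) / 2) x := by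
  have h : besselJ (n + 1) = fun x => (x / 2) ^ (n + 1) * besselAux (n + 1) (x ^ 2 / 4) := by
    ext x; exact besselJ_eq_besselAux _ _
  rw [h, besselJ_eq_besselAux, besselJ_eq_besselAux, besselAux_eq n]
  refine ((((hasDerivAt_id x).div_const 2).pow (n + 1)).mul
    (hasDerivAt_besselAux_comp (n + 1) x)).congr_deriv ?_
  simp only [id, Nat.add_sub_cancel, Pi.pow_apply]
  push_cast
  ring

theorem continuous_besselJ (n : ℕ) : Continuous (besselJ n) := by
  rcases n with _ | n
  · exact continuous_iff_continuousAt.2 fun x => (hasDerivAt_besselJ_zero x).continuousAt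
  · exact continuous_iff_continuousAt.2 fun x => (hasDerivAt_besselJ_succ n x).continuousAt

theorem besselJ_zero_zero : besselJ 0 0 = 1 := by
  rw [besselJ_eq_besselAux, besselAux, tsum_eq_single 0]
  · simp
  · intro k hk; simp [hk]

theorem besselJ_succ_zero (n : ℕ) : besselJ (n + 1) 0 = 0 := by
  simp [besselJ_eq_besselAux]

theorem besselJ_zero_one_sq_le :
    ∃ K : ℝ, ∀ x : ℝ, 1 ≤ x → (besselJ 0 x ^ 2 + besselJ 1 x ^ 2) * x ≤ K := by
  set W : ℝ → ℝ := fun x =>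
    x * (besselJ 0 x ^ 2 + besselJ 1 x ^ 2) - besselJ 0 x * besselJ 1 x with hW
  have hW' : ∀ x : ℝ, 0 < x → HasDerivAt W (besselJ 0 x * besselJ 1 x / x) x := by
    intro x hx
    have h0 := hasDerivAt_besselJ_zero x
    have h1 : HasDerivAt (besselJ 1) (besselJ 0 x - besselJ 1 x / x) x := by
      refine (hasDerivAt_besselJ_succ 0 x).congr_deriv ?_
      have := mul_besselJ_add 0 x
      push_cast at this
      field_simp
      norm_num at this ⊢
      linarith
    refine (((hasDerivAt_id x).mul ((h0.pow 2).add (h1.pow 2))).sub (h0.mul h1)).congr_deriv ?_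
    simp only [id, Pi.add_apply, Pi.pow_apply]
    push_cast
    field_simp
    ring
  have hpos : ∀ x : ℝ, 1 ≤ x → x / 2 * (besselJ 0 x ^ 2 + besselJ 1 x ^ 2) ≤ W x := by
    intro x hx
    simp only [hW]
    nlinarith [sq_nonneg (besselJ 0 x - besselJ 1 x), sq_nonneg (besselJ 0 x),
      sq_nonneg (besselJ 1 x)]
  have hV' : ∀ x : ℝ, 0 < x → HasDerivAt (fun x => W x * exp x⁻¹)
      (exp x⁻¹ * (besselJ 0 x * besselJ 1 x / x - W x / x ^ 2)) x := by
    intro x hx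
    refine ((hW' x hx).mul (hasDerivAt_inv hx.ne').exp).congr_deriv ?_
    field_simp
    ring
  have hanti : AntitoneOn (fun x => W x * exp x⁻¹) (Set.Ici 1) := by
    refine antitoneOn_of_hasDerivWithinAt_nonpos (convex_Ici 1)
      (fun x hx => (hV' x (zero_lt_one.trans_le hx)).continuousAt.continuousWithinAt)
      (f' := fun x => exp x⁻¹ * (besselJ 0 x * besselJ 1 x / x - W x / x ^ 2)) ?_ ?_
    · intro x hx
      rw [interior_Ici] at hx
      exact (hV' x (zero_lt_one.trans hx)).hasDerivWithinAt
    · intro x hx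
      rw [interior_Ici, Set.mem_Ioi] at hx
      have hx0 : 0 < x := by linarith
      refine mul_nonpos_of_nonneg_of_nonpos (exp_pos _).le ?_
      rw [sub_nonpos, div_le_div_iff₀ hx0 (by positivity)]
      have := hpos x hx.le
      have h2 : besselJ 0 x * besselJ 1 x * x ≤ W x := by
        nlinarith [mul_nonneg hx0.le (sq_nonneg (besselJ 0 x - besselJ 1 x))]
      nlinarith
  refine ⟨2 * (W 1 * exp 1⁻¹), fun x hx => ?_⟩
  have h1 := hanti (Set.mem_Ici.2 le_rfl) (Set.mem_Ici.2 hx) hx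
  have h2 := hpos x hx
  have h3 : 0 ≤ W x := le_trans (by positivity) h2
  have h4 : W x ≤ W x * exp x⁻¹ :=
    le_mul_of_one_le_right h3 (one_le_exp (by positivity))
  simp only at h1
  linarith

theorem abs_besselJ_mul_sqrt_le (n : ℕ) :
    ∃ C : ℝ, ∀ x : ℝ, 1 ≤ x → |besselJ n x| * √x ≤ C := by
  induction n using Nat.twoStepInduction with
  | zero =>
    obtain ⟨K, hK⟩ := besselJ_zero_one_sq_le
    refine ⟨√K, fun x hx => Real.le_sqrt_of_sq_le ?_⟩
    rw [mul_pow, sq_abs, Real.sq_sqrt (by linarith)]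
    nlinarith [hK x hx, mul_nonneg (sq_nonneg (besselJ 1 x)) (zero_le_one.trans hx)]
  | one =>
    obtain ⟨K, hK⟩ := besselJ_zero_one_sq_le
    refine ⟨√K, fun x hx => Real.le_sqrt_of_sq_le ?_⟩
    rw [mul_pow, sq_abs, Real.sq_sqrt (by linarith)]
    nlinarith [hK x hx, mul_nonneg (sq_nonneg (besselJ 0 x)) (zero_le_one.trans hx)]
  | more n h0 h1 =>
    obtain ⟨A, hA⟩ := h0
    obtain ⟨B, hB⟩ := h1
    refine ⟨2 * (n + 1) * B + A, fun x hx => ?_⟩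
    have hx0 : 0 < x := by linarith
    have hrec : besselJ (n + 2) x = 2 * (n + 1) * besselJ (n + 1) x / x - besselJ n x := by
      rw [← mul_besselJ_add]; field_simp; ring
    have h2 : |besselJ (n + 2) x| ≤ 2 * (n + 1) * |besselJ (n + 1) x| + |besselJ n x| := by
      rw [hrec]
      refine (abs_sub _ _).trans (add_le_add_left ?_ _)
      rw [abs_div, abs_of_pos hx0, abs_mul, abs_of_nonneg (by positivity : (0:ℝ) ≤ 2 * (n + 1))]
      exact div_le_self (by positivity) hx
    calc |besselJ (n + 2) x| * √x
        ≤ (2 * (n + 1) * |besselJ (n + 1) x| + |besselJ n x|) * √x := by gcongr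
      _ = 2 * (n + 1) * (|besselJ (n + 1) x| * √x) + |besselJ n x| * √x := by ring
      _ ≤ _ := by
        have := hA x hx
        have := hB x hx
        gcongr

theorem abs_besselJ_le (n : ℕ) :
    ∃ C : ℝ, 0 ≤ C ∧ ∀ x : ℝ, 0 ≤ x → |besselJ n x| ≤ C * (1 + x) ^ (-(1 / 2) : ℝ) := by
  obtain ⟨A, hA⟩ := abs_besselJ_mul_sqrt_le n
  obtain ⟨B, hB⟩ := (isCompact_Icc (a := (0 : ℝ)) (b := 1)).exists_bound_of_continuousOn
    (f := fun x => |besselJ n x| * √(1 + x))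
    ((((continuous_besselJ n).abs).mul (by fun_prop)).continuousOn)
  have key : ∀ x : ℝ, 0 ≤ x → |besselJ n x| * √(1 + x) ≤ max (2 * A) B := by
    intro x hx
    rcases le_total x 1 with h | h
    · exact ((Real.le_norm_self _).trans (hB x ⟨hx, h⟩)).trans (le_max_right _ _)
    · refine le_trans ?_ (le_max_left _ _)
      have h2 : √(1 + x) ≤ 2 * √x := by
        rw [Real.sqrt_le_left (by positivity), mul_pow, Real.sq_sqrt hx]
        linarith
      calc |besselJ n x| * √(1 + x) ≤ |besselJ n x| * (2 * √x) := by gcongr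
        _ = 2 * (|besselJ n x| * √x) := by ring
        _ ≤ 2 * A := by have := hA x h; gcongr
  refine ⟨max (2 * A) B, le_trans (by positivity) (key 0 le_rfl), fun x hx => ?_⟩
  have hp : 0 < √(1 + x) := Real.sqrt_pos.2 (by linarith)
  rw [Real.rpow_neg (by linarith), ← Real.sqrt_eq_rpow, ← div_eq_mul_inv, le_div_iff₀ hp]
  exact key x hx

theorem integral_cos_pow_odd_zero_pi (k : ℕ) : ∫ θ in (0 : ℝ)..π, cos θ ^ (2 * k + 1) = 0 := by
  induction k with
  | zero => simp
  | succ k ih =>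
    rw [show 2 * (k + 1) + 1 = 2 * k + 1 + 2 by ring, integral_cos_pow, ih]
    simp

theorem integral_cos_pow_even_zero_pi (k : ℕ) :
    ∫ θ in (0 : ℝ)..π, cos θ ^ (2 * k)
      = π * (Nat.factorial (2 * k) : ℝ) / (4 ^ k * (Nat.factorial k : ℝ) ^ 2) := by
  induction k with
  | zero => simp
  | succ k ih =>
    have h2 : (Nat.factorial k : ℝ) ≠ 0 := by exact_mod_cast Nat.factorial_ne_zero _
    rw [show 2 * (k + 1) = 2 * k + 2 by ring, integral_cos_pow, ih, Nat.factorial_succ,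
      Nat.factorial_succ, Nat.factorial_succ]
    push_cast
    simp only [sin_pi, sin_zero, mul_zero, sub_self, zero_div, zero_add]
    field_simp
    ring

theorem integral_exp_mul_cos (x : ℝ) :
    ∫ θ in (0 : ℝ)..π, Complex.exp (x * Complex.cos θ * Complex.I) = π * (besselJ 0 x : ℂ) := by
  have hsum : HasSum (fun k : ℕ => ∫ θ in (0 : ℝ)..π,
      (x * Complex.cos θ * Complex.I) ^ k / (Nat.factorial k : ℂ))
      (∫ θ in (0 : ℝ)..π, Complex.exp (x * Complex.cos θ * Complex.I)) := by
    refine intervalIntegral.hasSum_integral_of_dominated_convergence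
      (fun k _ => |x| ^ k / (Nat.factorial k : ℝ)) (fun k => ?_) (fun k => ?_) ?_ ?_ ?_
    · exact Continuous.aestronglyMeasurable (by fun_prop)
    · refine Filter.Eventually.of_forall fun θ _ => ?_
      rw [norm_div, norm_pow, Complex.norm_natCast, norm_mul, norm_mul, Complex.norm_I, mul_one,
        Complex.norm_real, ← Complex.ofReal_cos, Complex.norm_real, Real.norm_eq_abs,
        Real.norm_eq_abs]
      gcongr
      exact mul_le_of_le_one_right (abs_nonneg _) (abs_cos_le_one θ)
    · exact Filter.Eventually.of_forall fun θ _ => Real.summable_pow_div_factorial |x|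
    · simp
    · refine Filter.Eventually.of_forall fun θ _ => ?_
      rw [Complex.exp_eq_exp_ℂ]
      exact NormedSpace.expSeries_div_hasSum_exp _
  have hterm : ∀ k : ℕ, ∫ θ in (0 : ℝ)..π,
      (x * Complex.cos θ * Complex.I) ^ k / (Nat.factorial k : ℂ)
      = (x * Complex.I) ^ k / (Nat.factorial k : ℂ) *
        ((∫ θ in (0 : ℝ)..π, cos θ ^ k : ℝ) : ℂ) := by
    intro k
    rw [← intervalIntegral.integral_ofReal, ← intervalIntegral.integral_const_mul]
    congr 1
    ext θ
    push_cast
    ring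
  simp only [hterm] at hsum
  refine hsum.unique ?_
  rw [← add_zero ((π : ℂ) * _)]
  refine HasSum.even_add_odd ?_ ?_
  · have h := (((summable_besselAux 0 (x ^ 2 / 4)).hasSum).mapL Complex.ofRealCLM).mul_left (π : ℂ)
    have hJ : besselJ 0 x = besselAux 0 (x ^ 2 / 4) := by simp [besselJ_eq_besselAux]
    rw [hJ]
    refine h.congr_fun fun k => ?_
    have h1 : (Nat.factorial k : ℂ) ≠ 0 := by exact_mod_cast Nat.factorial_ne_zero _
    have h2 : (Nat.factorial (2 * k) : ℂ) ≠ 0 := by exact_mod_cast Nat.factorial_ne_zero _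
    rw [integral_cos_pow_even_zero_pi]
    simp only [Complex.ofRealCLM_apply, zero_add]
    push_cast
    rw [pow_mul, mul_pow (x : ℂ) Complex.I 2, Complex.I_sq, div_pow, mul_pow]
    field_simp
  · simp only [integral_cos_pow_odd_zero_pi]
    simp

/-- Entire functions of exponential type at most one that decay like `|z|^(-a)` along horizontal
lines. -/
def IsPaleyWiener (a : ℝ) (f : ℂ → ℂ) : Prop :=
  Differentiable ℂ f ∧ ∃ C : ℝ, 0 ≤ C ∧ ∀ z, ‖f z‖ ≤ C * (1 + ‖z‖) ^ (-a) * exp |z.im|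

theorem IsPaleyWiener.deriv {a : ℝ} {f : ℂ → ℂ} (ha : 0 ≤ a) (hf : IsPaleyWiener a f) :
    IsPaleyWiener a (deriv f) := by
  obtain ⟨hd, C, hC, hb⟩ := hf
  refine ⟨fun z => (hd.analyticAt z).deriv.differentiableAt, C * (2 ^ a * exp 1),
    by positivity, fun z => ?_⟩
  have key : ∀ w ∈ Metric.sphere z 1,
      ‖f w‖ ≤ C * (2 ^ a * exp 1) * (1 + ‖z‖) ^ (-a) * exp |z.im| := by
    intro w hw
    rw [mem_sphere_iff_norm] at hw
    have h1 : (1 + ‖z‖) / 2 ≤ 1 + ‖w‖ := by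
      have := norm_sub_norm_le z w
      rw [norm_sub_rev, hw] at this
      linarith [norm_nonneg w]
    have h2 : |w.im| ≤ |z.im| + 1 := by
      have h3 := Complex.abs_im_le_norm (w - z)
      have h4 := abs_sub_abs_le_abs_sub w.im z.im
      rw [hw, Complex.sub_im] at h3
      linarith
    have h3 : (1 + ‖w‖) ^ (-a) ≤ 2 ^ a * (1 + ‖z‖) ^ (-a) := by
      calc (1 + ‖w‖) ^ (-a) ≤ ((1 + ‖z‖) / 2) ^ (-a) :=
            Real.rpow_le_rpow_of_nonpos (by positivity) h1 (by linarith)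
        _ = 2 ^ a * (1 + ‖z‖) ^ (-a) := by
            rw [Real.div_rpow (by positivity) (by norm_num), Real.rpow_neg (by norm_num : (0:ℝ) ≤ 2)]
            field_simp
    calc ‖f w‖ ≤ C * (1 + ‖w‖) ^ (-a) * exp |w.im| := hb w
      _ ≤ C * (2 ^ a * (1 + ‖z‖) ^ (-a)) * exp (|z.im| + 1) := by gcongr
      _ = _ := by rw [exp_add]; ring
  simpa using Complex.norm_deriv_le_of_forall_mem_sphere_norm_le zero_lt_one hd.diffContOnCl key

theorem IsPaleyWiener.norm_ofReal_le {a : ℝ} {f : ℂ → ℂ} (hf : IsPaleyWiener a f) :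
    ∃ C : ℝ, 0 ≤ C ∧ ∀ x : ℝ, 0 ≤ x → ‖f x‖ ≤ C * (1 + x) ^ (-a) := by
  obtain ⟨-, C, hC, hb⟩ := hf
  refine ⟨C, hC, fun x hx => ?_⟩
  simpa [abs_of_nonneg hx] using hb x

theorem integrableOn_one_add_rpow {r : ℝ} (hr : 1 < r) :
    IntegrableOn (fun x : ℝ => (1 + x) ^ (-r)) (Set.Ioi 0) := by
  have h : Integrable (fun x : ℝ => (1 + ‖x‖) ^ (-r)) := integrable_one_add_norm (by simpa using hr)
  refine h.integrableOn.congr_fun (fun x hx => ?_) measurableSet_Ioi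
  simp only [Real.norm_eq_abs, abs_of_pos (Set.mem_Ioi.1 hx)]

theorem continuous_besselJ_mul {f : ℂ → ℂ} (hf : Continuous f) (n : ℕ) :
    Continuous fun x : ℝ => (besselJ n x : ℂ) * f x :=
  (Complex.continuous_ofReal.comp (continuous_besselJ n)).mul (hf.comp Complex.continuous_ofReal)

theorem IsPaleyWiener.norm_besselJ_mul_le {a : ℝ} {f : ℂ → ℂ} (hf : IsPaleyWiener a f) (n : ℕ) :
    ∃ C : ℝ, ∀ x : ℝ, 0 ≤ x → ‖(besselJ n x : ℂ) * f x‖ ≤ C * (1 + x) ^ (-(a + 1 / 2)) := by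
  obtain ⟨C, hC, hb⟩ := hf.norm_ofReal_le
  obtain ⟨B, hB, hJ⟩ := abs_besselJ_le n
  refine ⟨B * C, fun x hx => ?_⟩
  rw [norm_mul, Complex.norm_real, Real.norm_eq_abs]
  calc |besselJ n x| * ‖f x‖ ≤ (B * (1 + x) ^ (-(1 / 2) : ℝ)) * (C * (1 + x) ^ (-a)) := by
        have := hJ x hx
        have := hb x hx
        gcongr
    _ = B * C * ((1 + x) ^ (-a) * (1 + x) ^ (-(1 / 2) : ℝ)) := by ring
    _ = _ := by rw [← Real.rpow_add (by linarith)]; congr 2; ring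

theorem IsPaleyWiener.integrableOn_besselJ_mul {a : ℝ} {f : ℂ → ℂ} (ha : 1 / 2 < a)
    (hf : IsPaleyWiener a f) (n : ℕ) :
    IntegrableOn (fun x : ℝ => (besselJ n x : ℂ) * f x) (Set.Ioi 0) := by
  obtain ⟨C, hC⟩ := hf.norm_besselJ_mul_le n
  refine Integrable.mono' ((integrableOn_one_add_rpow (by linarith : 1 < a + 1 / 2)).const_mul C)
    (continuous_besselJ_mul hf.1.continuous n).aestronglyMeasurable ?_
  exact (ae_restrict_iff' measurableSet_Ioi).2
    (Filter.Eventually.of_forall fun x hx => hC x (Set.mem_Ioi.1 hx).le)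

theorem IsPaleyWiener.integrableOn {a : ℝ} {f : ℂ → ℂ} (ha : 1 < a)
    (hf : IsPaleyWiener a f) : IntegrableOn (fun x : ℝ => f x) (Set.Ioi 0) := by
  obtain ⟨C, -, hC⟩ := hf.norm_ofReal_le
  refine Integrable.mono' ((integrableOn_one_add_rpow ha).const_mul C)
    (hf.1.continuous.comp Complex.continuous_ofReal).aestronglyMeasurable ?_
  exact (ae_restrict_iff' measurableSet_Ioi).2
    (Filter.Eventually.of_forall fun x hx => hC x (Set.mem_Ioi.1 hx).le)

/-- The sine transform of an odd function of exponential type one vanishes outside `[-1, 1]`. -/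
theorem IsPaleyWiener.integral_mul_sin_eq_zero {f : ℂ → ℂ} (hf : IsPaleyWiener 2 f)
    (hodd : ∀ z, f (-z) = -f z) {t : ℝ} (ht : 1 ≤ t) :
    ∫ x in Set.Ioi (0 : ℝ), f x * (sin (t * x) : ℝ) = 0 := by
  obtain ⟨hd, C, hC, hb⟩ := hf
  set F : ℂ → ℂ := fun z => f z * Complex.exp (t * z * Complex.I) with hF
  have hFd : Differentiable ℂ F := by fun_prop
  have hFb : ∀ (T : ℝ), 0 ≤ T → ∀ z : ℂ, 0 ≤ z.im → T ≤ ‖z‖ → ‖F z‖ ≤ C * (1 + T) ^ (-2 : ℝ) := by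
    intro T hT z hz hTz
    have h1 : ‖Complex.exp (t * z * Complex.I)‖ = exp (-(t * z.im)) := by
      rw [Complex.norm_exp]; simp
    rw [hF]
    simp only [norm_mul, h1]
    calc ‖f z‖ * exp (-(t * z.im)) ≤ (C * (1 + ‖z‖) ^ (-2 : ℝ) * exp |z.im|) * exp (-(t * z.im)) := by
          gcongr; exact hb z
      _ = C * (1 + ‖z‖) ^ (-2 : ℝ) * exp (z.im - t * z.im) := by
          rw [abs_of_nonneg hz, sub_eq_add_neg, exp_add]; ring
      _ ≤ C * (1 + T) ^ (-2 : ℝ) * 1 := by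
          gcongr ?_ * ?_ * ?_
          · exact Real.rpow_le_rpow_of_nonpos (by positivity) (by linarith) (by norm_num)
          · rw [exp_le_one_iff]; nlinarith
      _ = _ := mul_one _
  have hrect : ∀ T : ℝ, 0 ≤ T → ‖∫ x in (-T)..T, F x‖ ≤ 4 * C * (1 + T)⁻¹ := by
    intro T hT
    have h := Complex.integral_boundary_rect_eq_zero_of_differentiableOn F (-T : ℂ) (T + T * Complex.I)
      hFd.differentiableOn
    simp only [Complex.neg_re, Complex.ofReal_re, Complex.neg_im, Complex.ofReal_im, neg_zero,
      Complex.add_re, Complex.mul_re, Complex.I_re, mul_zero, Complex.I_im, mul_one, sub_self,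
      add_zero, Complex.add_im, Complex.mul_im, zero_add, Complex.ofReal_zero, zero_mul,
      smul_eq_mul] at h
    set c := C * (1 + T) ^ (-2 : ℝ)
    have e1 : ‖∫ x in (-T)..T, F (x + T * Complex.I)‖ ≤ c * |T - -T| :=
      intervalIntegral.norm_integral_le_of_norm_le_const fun x _ => hFb T hT _ (by simpa) <| by
        simpa [abs_of_nonneg hT] using Complex.abs_im_le_norm (x + T * Complex.I)
    have e2 : ‖∫ y in (0:ℝ)..T, F (T + y * Complex.I)‖ ≤ c * |T - 0| :=
      intervalIntegral.norm_integral_le_of_norm_le_const fun y hy => by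
        rw [Set.uIoc_of_le hT] at hy
        refine hFb T hT _ (by simpa using hy.1.le) ?_
        simpa [abs_of_nonneg hT] using Complex.abs_re_le_norm (T + y * Complex.I)
    have e3 : ‖∫ y in (0:ℝ)..T, F (((-T : ℝ) : ℂ) + y * Complex.I)‖ ≤ c * |T - 0| :=
      intervalIntegral.norm_integral_le_of_norm_le_const fun y hy => by
        rw [Set.uIoc_of_le hT] at hy
        refine hFb T hT _ (by simpa using hy.1.le) ?_
        simpa [abs_of_nonneg hT] using Complex.abs_re_le_norm (((-T : ℝ) : ℂ) + y * Complex.I)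
    have e4 : ∫ x in (-T)..T, F x = (∫ x in (-T)..T, F (x + T * Complex.I))
        - Complex.I * (∫ y in (0:ℝ)..T, F (T + y * Complex.I))
        + Complex.I * ∫ y in (0:ℝ)..T, F (((-T : ℝ) : ℂ) + y * Complex.I) := by
      linear_combination h
    have hc : c * (1 + T) = C * (1 + T)⁻¹ := by
      have : (1 + T) ≠ 0 := by positivity
      simp only [c, Real.rpow_neg (by positivity : 0 ≤ 1 + T), Real.rpow_two]
      field_simp
    have hc0 : 0 ≤ c := by positivity
    rw [e4]
    refine (norm_add_le _ _).trans ((add_le_add_left (norm_sub_le _ _) _).trans ?_)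
    rw [norm_mul, norm_mul, Complex.norm_I, one_mul, one_mul]
    rw [abs_of_nonneg (by linarith)] at e1 e2 e3
    nlinarith
  have hlim : Filter.Tendsto (fun T : ℝ => ∫ x in (-T)..T, F x) Filter.atTop (nhds 0) := by
    refine squeeze_zero_norm' (Filter.eventually_atTop.2 ⟨0, fun T hT => hrect T hT⟩) ?_
    simpa using (tendsto_inv_atTop_zero.comp
      (Filter.tendsto_atTop_add_const_left _ 1 Filter.tendsto_id)).const_mul (4 * C)
  have hsplit : ∀ T : ℝ, ∫ x in (-T)..T, F x
      = 2 * Complex.I * ∫ x in (0:ℝ)..T, f x * (sin (t * x) : ℝ) := by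
    intro T
    have hc : Continuous fun x : ℝ => F x := hFd.continuous.comp Complex.continuous_ofReal
    have hc' : Continuous fun x : ℝ => F ((-x : ℝ) : ℂ) :=
      hFd.continuous.comp (Complex.continuous_ofReal.comp continuous_neg)
    rw [← intervalIntegral.integral_add_adjacent_intervals (hc.intervalIntegrable (-T) 0)
      (hc.intervalIntegrable 0 T)]
    have : ∫ x in (-T)..0, F x = ∫ x in (0:ℝ)..T, F ((-x : ℝ) : ℂ) := by
      rw [intervalIntegral.integral_comp_neg (fun x : ℝ => F x)]; simp
    rw [this, ← intervalIntegral.integral_add (hc'.intervalIntegrable 0 T)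
      (hc.intervalIntegrable 0 T), ← intervalIntegral.integral_const_mul]
    congr 1
    ext x
    simp only [hF]
    push_cast
    rw [hodd, Complex.sin]
    have : (t : ℂ) * -x * Complex.I = -(t * x) * Complex.I := by ring
    rw [this]
    linear_combination -(f x * (Complex.exp (-(t * x) * Complex.I) -
      Complex.exp (t * x * Complex.I))) * Complex.I_sq
  have hfint : IntegrableOn (fun x : ℝ => f x * (sin (t * x) : ℝ)) (Set.Ioi 0) := by
    refine Integrable.mul_bdd (c := 1)
      (IsPaleyWiener.integrableOn one_lt_two ⟨hd, C, hC, hb⟩) ?_ ?_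
    · exact Continuous.aestronglyMeasurable (by fun_prop)
    · exact Filter.Eventually.of_forall fun x => by
        rw [Complex.norm_real]; exact abs_sin_le_one _
  have h2 := (intervalIntegral_tendsto_integral_Ioi 0 hfint Filter.tendsto_id).const_mul
    (2 * Complex.I)
  simp only [hsplit] at hlim
  have := tendsto_nhds_unique h2 hlim
  simpa using this

theorem norm_exp_mul_cos (x u y : ℝ) :
    ‖Complex.exp (x * Complex.cos (u + y * Complex.I) * Complex.I)‖
      = exp (x * sin u * sinh y) := by
  rw [Complex.norm_exp, Complex.cos_add_mul_I]
  congr 1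
  rw [← Complex.ofReal_cos, ← Complex.ofReal_sin, ← Complex.ofReal_cosh, ← Complex.ofReal_sinh]
  simp only [Complex.mul_re, Complex.mul_im, Complex.sub_re, Complex.sub_im, Complex.ofReal_re,
    Complex.ofReal_im, Complex.I_re, Complex.I_im]
  ring

/-- A truncated form of the Mehler–Sonine integral for `J₀`. -/
theorem pi_mul_besselJ_zero (x R : ℝ) :
    π * (besselJ 0 x : ℂ)
      = (∫ u in (0 : ℝ)..π, Complex.exp (x * Complex.cos (u + (-R : ℝ) * Complex.I) * Complex.I))
        - 2 * ∫ y in (0 : ℝ)..(-R), (sin (cosh y * x) : ℂ) := by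
  set E : ℂ → ℂ := fun θ => Complex.exp (x * Complex.cos θ * Complex.I) with hE
  have hEd : Differentiable ℂ E := by fun_prop
  have h := Complex.integral_boundary_rect_eq_zero_of_differentiableOn E 0
    (π + (-R : ℝ) * Complex.I) hEd.differentiableOn
  simp only [Complex.zero_re, Complex.zero_im, Complex.add_re, Complex.ofReal_re, Complex.mul_re,
    Complex.I_re, mul_zero, Complex.ofReal_im, Complex.I_im, mul_one, sub_self, add_zero,
    Complex.add_im, Complex.mul_im, zero_add, Complex.ofReal_zero, zero_mul, smul_eq_mul] at h
  have hside : (∫ y in (0 : ℝ)..(-R), E (π + y * Complex.I))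
      - (∫ y in (0 : ℝ)..(-R), E (y * Complex.I))
      = -2 * Complex.I * ∫ y in (0 : ℝ)..(-R), (sin (cosh y * x) : ℂ) := by
    rw [← intervalIntegral.integral_sub, ← intervalIntegral.integral_const_mul]
    · congr 1
      ext y
      simp only [hE]
      rw [Complex.cos_mul_I, add_comm (π : ℂ), Complex.cos_add_pi, Complex.cos_mul_I]
      push_cast
      rw [Complex.sin]
      have e1 : (x : ℂ) * -Complex.cosh y * Complex.I = -(Complex.cosh y * x) * Complex.I := by ring
      have e2 : (x : ℂ) * Complex.cosh y * Complex.I = (Complex.cosh y * x) * Complex.I := by ring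
      rw [e1, e2]
      linear_combination (Complex.exp (-(Complex.cosh y * x) * Complex.I) -
        Complex.exp (Complex.cosh y * x * Complex.I)) * Complex.I_sq
    · exact Continuous.intervalIntegrable (hEd.continuous.comp (by fun_prop)) _ _
    · exact Continuous.intervalIntegrable (hEd.continuous.comp (by fun_prop)) _ _
  have h0 := integral_exp_mul_cos x
  simp only [hE] at h hside
  rw [h0] at h
  linear_combination h - Complex.I * hside +
    2 * (∫ y in (0 : ℝ)..(-R), (sin (cosh y * x) : ℂ)) * Complex.I_sq

theorem norm_exp_mul_cos_le_one {x u R : ℝ} (hx : 0 ≤ x) (hu : u ∈ Set.uIoc 0 π) (hR : 0 ≤ R) :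
    ‖Complex.exp (x * Complex.cos (u + (-R : ℝ) * Complex.I) * Complex.I)‖ ≤ 1 := by
  rw [Set.uIoc_of_le pi_pos.le] at hu
  have h := sin_nonneg_of_nonneg_of_le_pi hu.1.le hu.2
  rw [norm_exp_mul_cos, exp_le_one_iff, sinh_neg, mul_neg, neg_nonpos]
  have := sinh_nonneg_iff.2 hR
  positivity

theorem tendsto_integral_exp_mul_cos {x : ℝ} (hx : 0 < x) :
    Filter.Tendsto (fun R : ℝ => ∫ u in (0 : ℝ)..π,
      Complex.exp (x * Complex.cos (u + (-R : ℝ) * Complex.I) * Complex.I))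
      Filter.atTop (nhds 0) := by
  have h0 : (0 : ℂ) = ∫ u in (0 : ℝ)..π, (0 : ℂ) := by simp
  rw [h0]
  refine intervalIntegral.tendsto_integral_filter_of_dominated_convergence (fun _ => 1) ?_ ?_ ?_ ?_
  · exact Filter.Eventually.of_forall fun R => Continuous.aestronglyMeasurable (by fun_prop)
  · filter_upwards [Filter.eventually_ge_atTop 0] with R hR
    exact Filter.Eventually.of_forall fun u hu => norm_exp_mul_cos_le_one hx.le hu hR
  · simp
  · have hne : ∀ᵐ u : ℝ, u ≠ π := by simp [ae_iff]
    filter_upwards [hne] with u hu hmem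
    rw [Set.uIoc_of_le pi_pos.le] at hmem
    have hs : 0 < sin u := sin_pos_of_pos_of_lt_pi hmem.1 (lt_of_le_of_ne hmem.2 hu)
    rw [tendsto_zero_iff_norm_tendsto_zero]
    simp only [norm_exp_mul_cos]
    refine tendsto_exp_atBot.comp ?_
    have h1 : Filter.Tendsto (fun R : ℝ => sinh R) Filter.atTop Filter.atTop :=
      Filter.tendsto_atTop_mono' _ (by
        filter_upwards [Filter.eventually_ge_atTop 0] with R hR
        exact self_le_sinh_iff.2 hR) Filter.tendsto_id
    have h2 := Filter.tendsto_neg_atTop_atBot.comp (h1.const_mul_atTop (mul_pos hx hs))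
    refine h2.congr fun R => ?_
    simp

theorem IsPaleyWiener.integral_besselJ_zero_mul_of_two {f : ℂ → ℂ} (hf : IsPaleyWiener 2 f)
    (hodd : ∀ z, f (-z) = -f z) :
    ∫ x in Set.Ioi (0 : ℝ), (besselJ 0 x : ℂ) * f x = 0 := by
  have hfi : IntegrableOn (fun x : ℝ => f x) (Set.Ioi 0) := hf.integrableOn one_lt_two
  have hfc : Continuous fun x : ℝ => f x := hf.1.continuous.comp Complex.continuous_ofReal
  set top : ℝ → ℝ → ℂ := fun R x => ∫ u in (0 : ℝ)..π,
    Complex.exp (x * Complex.cos (u + (-R : ℝ) * Complex.I) * Complex.I) with htop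
  have htopc : ∀ R, Continuous (top R) := fun R =>
    intervalIntegral.continuous_parametric_intervalIntegral_of_continuous' (by fun_prop) _ _
  have htopb : ∀ R, 0 ≤ R → ∀ x, 0 ≤ x → ‖top R x‖ ≤ π := by
    intro R hR x hx
    have := intervalIntegral.norm_integral_le_of_norm_le_const
      (fun u hu => norm_exp_mul_cos_le_one hx (u := u) hu hR)
    rwa [one_mul, sub_zero, abs_of_pos pi_pos] at this
  have hswap : ∀ R : ℝ, IntegrableOn (fun x : ℝ => f x * ∫ y in (0 : ℝ)..(-R),
      (sin (cosh y * x) : ℂ)) (Set.Ioi 0) ∧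
      ∫ x in Set.Ioi (0 : ℝ), f x * ∫ y in (0 : ℝ)..(-R), (sin (cosh y * x) : ℂ) = 0 := by
    intro R
    have : IsFiniteMeasure (volume.restrict (Set.uIoc 0 (-R))) := by
      unfold Set.uIoc; infer_instance
    have hi : Integrable (Function.uncurry fun (y x : ℝ) => f x * (sin (cosh y * x) : ℂ))
        ((volume.restrict (Set.uIoc 0 (-R))).prod (volume.restrict (Set.Ioi 0))) := by
      refine Integrable.mul_bdd (c := 1) (Integrable.comp_snd hfi _) ?_ ?_
      · exact Continuous.aestronglyMeasurable (by fun_prop)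
      · exact Filter.Eventually.of_forall fun p => by
          rw [Complex.norm_real]; exact abs_sin_le_one _
    have hc : Continuous fun x : ℝ => ∫ y in (0 : ℝ)..(-R), (sin (cosh y * x) : ℂ) :=
      intervalIntegral.continuous_parametric_intervalIntegral_of_continuous' (by fun_prop) _ _
    refine ⟨Integrable.mul_bdd (c := 1 * |-R - 0|) hfi hc.aestronglyMeasurable
      (Filter.Eventually.of_forall fun x => ?_), ?_⟩
    · exact intervalIntegral.norm_integral_le_of_norm_le_const fun y _ => by
        rw [Complex.norm_real]; exact abs_sin_le_one _
    · have h := intervalIntegral_integral_swap hi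
      simp only [intervalIntegral.integral_const_mul,
        hf.integral_mul_sin_eq_zero hodd (one_le_cosh _), intervalIntegral.integral_zero] at h
      exact h.symm
  have heq : ∀ R : ℝ, 0 ≤ R → π * ∫ x in Set.Ioi (0 : ℝ), (besselJ 0 x : ℂ) * f x
      = ∫ x in Set.Ioi (0 : ℝ), f x * top R x := by
    intro R hR
    have hi : IntegrableOn (fun x : ℝ => f x * top R x) (Set.Ioi 0) := by
      refine Integrable.mul_bdd (c := π) hfi (htopc R).aestronglyMeasurable ?_
      exact (ae_restrict_iff' measurableSet_Ioi).2
        (Filter.Eventually.of_forall fun x hx => htopb R hR x (Set.mem_Ioi.1 hx).le)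
    have h2 := integral_sub hi ((hswap R).1.const_mul 2)
    rw [integral_const_mul, (hswap R).2, mul_zero, sub_zero] at h2
    rw [← h2, ← integral_const_mul]
    congr 1
    ext x
    rw [← mul_assoc, pi_mul_besselJ_zero x R]
    ring
  have hlim : Filter.Tendsto (fun R : ℝ => ∫ x in Set.Ioi (0 : ℝ), f x * top R x)
      Filter.atTop (nhds (∫ x in Set.Ioi (0 : ℝ), (0 : ℂ))) := by
    refine tendsto_integral_filter_of_dominated_convergence (fun x => ‖f x‖ * π) ?_ ?_
      (hfi.norm.mul_const π) ?_
    · exact Filter.Eventually.of_forall fun R => (hfc.mul (htopc R)).aestronglyMeasurable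
    · filter_upwards [Filter.eventually_ge_atTop 0] with R hR
      refine (ae_restrict_iff' measurableSet_Ioi).2 (Filter.Eventually.of_forall fun x hx => ?_)
      rw [norm_mul]
      have := htopb R hR x (Set.mem_Ioi.1 hx).le
      gcongr
    · refine (ae_restrict_iff' measurableSet_Ioi).2 (Filter.Eventually.of_forall fun x hx => ?_)
      have := (tendsto_integral_exp_mul_cos (Set.mem_Ioi.1 hx)).const_mul (f x)
      rwa [mul_zero] at this
  have hconst : Filter.Tendsto (fun _ : ℝ => (π : ℂ) *
      ∫ x in Set.Ioi (0 : ℝ), (besselJ 0 x : ℂ) * f x) Filter.atTop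
      (nhds (∫ x in Set.Ioi (0 : ℝ), (0 : ℂ))) :=
    hlim.congr' (by
      filter_upwards [Filter.eventually_ge_atTop 0] with R hR
      exact (heq R hR).symm)
  have := tendsto_nhds_unique tendsto_const_nhds hconst
  simpa [pi_ne_zero] using this

theorem abs_log_norm_one_add_sub_re_le {z : ℂ} (hz : ‖z‖ ≤ 1 / 2) :
    |log ‖1 + z‖ - z.re| ≤ ‖z‖ ^ 2 := by
  have h1 := Complex.norm_log_one_add_sub_self_le (z := z) (by linarith)
  have h2 := Complex.abs_re_le_norm (Complex.log (1 + z) - z)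
  rw [Complex.sub_re, Complex.log_re] at h2
  refine h2.trans (h1.trans ?_)
  have h3 : (1 - ‖z‖)⁻¹ ≤ 2 := by
    rw [inv_le_comm₀ (by linarith) (by norm_num)]; linarith
  have := mul_le_mul_of_nonneg_left h3 (sq_nonneg ‖z‖)
  linarith

theorem norm_le_norm_add_mul_rpow (c : ℝ) {u : ℂ} (hu : 2 + 2 * |c| ≤ ‖u‖) :
    ‖u‖ ≤ ‖u + c‖ * exp ((c ^ 2 + |c|) / ‖u‖ ^ 2) * (‖u‖ / ‖u + 1‖) ^ c := by
  have hc := abs_nonneg c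
  have hu0 : 0 < ‖u‖ := by linarith
  have hune : u ≠ 0 := norm_pos_iff.1 hu0
  have hz1 : ‖(1 : ℂ) / u‖ ≤ 1 / 2 := by
    rw [norm_div, norm_one, div_le_div_iff₀ hu0 (by norm_num)]; linarith
  have hz2 : ‖(c : ℂ) / u‖ ≤ 1 / 2 := by
    rw [norm_div, Complex.norm_real, Real.norm_eq_abs, div_le_div_iff₀ hu0 (by norm_num)]; linarith
  have h1 := abs_log_norm_one_add_sub_re_le hz1
  have h2 := abs_log_norm_one_add_sub_re_le hz2
  have hne : ∀ z : ℂ, ‖z‖ ≤ 1 / 2 → 0 < ‖1 + z‖ := fun z hz => by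
    have := norm_sub_norm_le (1 : ℂ) (-z)
    rw [norm_one, norm_neg, sub_neg_eq_add] at this
    linarith
  have hp1 := hne _ hz1
  have hp2 := hne _ hz2
  have hre : ((c : ℂ) / u).re = c * ((1 : ℂ) / u).re := by
    rw [show (c : ℂ) / u = c * (1 / u) by ring, Complex.re_ofReal_mul]
  have e1 : ‖u + 1‖ = ‖u‖ * ‖1 + 1 / u‖ := by
    rw [← norm_mul]; congr 1; field_simp
  have e2 : ‖u + c‖ = ‖u‖ * ‖1 + (c : ℂ) / u‖ := by
    rw [← norm_mul]; congr 1; field_simp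
  have key : c * log ‖1 + 1 / u‖ ≤ log ‖1 + (c : ℂ) / u‖ + (c ^ 2 + |c|) / ‖u‖ ^ 2 := by
    have h3 : |c * (log ‖1 + 1 / u‖ - ((1 : ℂ) / u).re)| ≤ |c| * ‖(1 : ℂ) / u‖ ^ 2 := by
      rw [abs_mul]; gcongr
    rw [hre] at h2
    have h4 := (abs_le.1 h3).2
    have h5 := (abs_le.1 h2).1
    have h6 : ‖(1 : ℂ) / u‖ ^ 2 = 1 / ‖u‖ ^ 2 := by rw [norm_div, norm_one, div_pow, one_pow]
    have h7 : ‖(c : ℂ) / u‖ ^ 2 = c ^ 2 / ‖u‖ ^ 2 := by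
      rw [norm_div, Complex.norm_real, Real.norm_eq_abs, div_pow, sq_abs]
    rw [h6] at h4
    rw [h7] at h5
    have : (c ^ 2 + |c|) / ‖u‖ ^ 2 = c ^ 2 / ‖u‖ ^ 2 + |c| * (1 / ‖u‖ ^ 2) := by ring
    linarith
  have h8 : (‖u‖ / ‖u + 1‖) ^ c = exp (-(c * log ‖1 + 1 / u‖)) := by
    rw [e1, Real.rpow_def_of_pos (by positivity), div_mul_cancel_left₀ hu0.ne', log_inv]
    congr 1; ring
  rw [e2, h8, mul_assoc, mul_assoc, ← exp_add]
  refine le_mul_of_one_le_right hu0.le ?_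
  nth_rewrite 1 [← exp_log hp2]
  rw [← exp_add]
  exact one_le_exp (by linarith)

theorem sq_add_one_le_norm_add_natCast_sq {w : ℂ} (hw : 0 ≤ w.re) (h1 : 1 ≤ ‖w‖) (j : ℕ) :
    (j : ℝ) ^ 2 + 1 ≤ ‖w + j‖ ^ 2 := by
  have h2 : 1 ≤ ‖w‖ ^ 2 := one_le_pow₀ h1
  rw [Complex.sq_norm, Complex.normSq_apply] at h2 ⊢
  simp only [Complex.add_re, Complex.natCast_re, Complex.add_im, Complex.natCast_im, add_zero]
  have : 0 ≤ w.re * j := by positivity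
  nlinarith

theorem norm_le_norm_add_natCast {w : ℂ} (hw : 0 ≤ w.re) (j : ℕ) : ‖w‖ ≤ ‖w + j‖ := by
  refine (sq_le_sq₀ (norm_nonneg _) (norm_nonneg _)).1 ?_
  rw [Complex.sq_norm, Complex.sq_norm, Complex.normSq_apply, Complex.normSq_apply]
  simp only [Complex.add_re, Complex.natCast_re, Complex.add_im, Complex.natCast_im, add_zero]
  have : 0 ≤ w.re * j := by positivity
  nlinarith [sq_nonneg (j : ℝ)]

theorem prod_norm_le_prod_norm_add (c : ℝ) {w : ℂ} (hw : 0 ≤ w.re) (h : 2 + 2 * |c| ≤ ‖w‖)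
    (n : ℕ) :
    ∏ j ∈ Finset.range n, ‖w + j‖ ≤ (∏ j ∈ Finset.range n, ‖w + c + j‖) *
      exp ((c ^ 2 + |c|) * ∑ j ∈ Finset.range n, 1 / ((j : ℝ) ^ 2 + 1)) *
      (‖w‖ / ‖w + n‖) ^ c := by
  have hc := abs_nonneg c
  have hw0 : 0 < ‖w‖ := by linarith
  have hpos : ∀ j : ℕ, 0 < ‖w + j‖ := fun j => hw0.trans_le (norm_le_norm_add_natCast hw j)
  induction n with
  | zero => simp [hw0.ne']
  | succ n ih =>
    have hn := norm_le_norm_add_mul_rpow c (h.trans (norm_le_norm_add_natCast hw n))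
    have hn2 : (c ^ 2 + |c|) / ‖w + n‖ ^ 2 ≤ (c ^ 2 + |c|) * (1 / ((n : ℝ) ^ 2 + 1)) := by
      rw [mul_one_div]
      gcongr
      exact sq_add_one_le_norm_add_natCast_sq hw (by linarith) n
    have hs : w + n + 1 = w + (n + 1 : ℕ) := by push_cast; ring
    rw [hs] at hn
    rw [Finset.prod_range_succ, Finset.prod_range_succ, Finset.sum_range_succ, mul_add, exp_add]
    have hr : (‖w‖ / ‖w + (n + 1 : ℕ)‖) ^ c
        = (‖w‖ / ‖w + n‖) ^ c * (‖w + n‖ / ‖w + (n + 1 : ℕ)‖) ^ c := by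
      rw [← Real.mul_rpow (by positivity) (by positivity), div_mul_div_cancel₀ (hpos n).ne']
    rw [hr]
    calc (∏ j ∈ Finset.range n, ‖w + j‖) * ‖w + n‖
        ≤ ((∏ j ∈ Finset.range n, ‖w + c + j‖) *
            exp ((c ^ 2 + |c|) * ∑ j ∈ Finset.range n, 1 / ((j : ℝ) ^ 2 + 1)) *
            (‖w‖ / ‖w + n‖) ^ c) *
          (‖w + n + c‖ * exp ((c ^ 2 + |c|) * (1 / ((n : ℝ) ^ 2 + 1))) *
            (‖w + n‖ / ‖w + (n + 1 : ℕ)‖) ^ c) := by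
          refine mul_le_mul ih (hn.trans ?_) (norm_nonneg _)
            (le_trans (Finset.prod_nonneg fun _ _ => norm_nonneg _) ih)
          gcongr
      _ = _ := by rw [show w + n + c = w + c + n by ring]; ring

theorem summable_one_div_sq_add_one : Summable fun j : ℕ => 1 / ((j : ℝ) ^ 2 + 1) := by
  refine (summable_nat_add_iff 1).1 (Summable.of_nonneg_of_le (fun j => by positivity) (fun j => ?_)
    ((summable_nat_add_iff 1).2 (Real.summable_one_div_nat_pow.2 one_lt_two)))
  gcongr
  linarith

/-- Upper bound for a ratio of Gamma values in the right half-plane. -/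
theorem norm_Gamma_add_le (c : ℝ) : ∃ A : ℝ, 0 ≤ A ∧ ∀ w : ℂ, 0 ≤ w.re → 2 + 2 * |c| ≤ ‖w‖ →
    ‖Complex.Gamma (w + c)‖ ≤ A * ‖w‖ ^ c * ‖Complex.Gamma w‖ := by
  set A := exp ((c ^ 2 + |c|) * ∑' j : ℕ, 1 / ((j : ℝ) ^ 2 + 1)) with hA
  refine ⟨A, (exp_pos _).le, fun w hw h => ?_⟩
  have hc := abs_nonneg c
  have hw0 : 0 < ‖w‖ := by linarith
  have hpos : ∀ j : ℕ, 0 < ‖w + j‖ := fun j => hw0.trans_le (norm_le_norm_add_natCast hw j)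
  have hposc : ∀ j : ℕ, 0 < ‖w + c + j‖ := fun j => by
    have := norm_sub_norm_le (w + j) (-c : ℂ)
    rw [norm_neg, Complex.norm_real, Real.norm_eq_abs, sub_neg_eq_add] at this
    rw [show w + c + j = w + j + c by ring]
    linarith [norm_le_norm_add_natCast hw j]
  have hlim : Filter.Tendsto (fun n : ℕ => (n / ‖w + (n + 1 : ℕ)‖ : ℝ) ^ c) Filter.atTop
      (nhds 1) := by
    have h1 : Filter.Tendsto (fun n : ℕ => (n / (w + (n + 1 : ℕ)) : ℂ)) Filter.atTop (nhds 1) := by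
      have := tendsto_natCast_div_add_atTop (𝕜 := ℂ) (w + 1)
      refine this.congr fun n => ?_
      push_cast
      ring
    have h2 := (h1.norm).rpow_const (p := c) (by simp)
    simpa using h2
  have hseq : ∀ n : ℕ, 0 < n → ‖Complex.GammaSeq (w + c) n‖
      ≤ (A * ‖w‖ ^ c) * (n / ‖w + (n + 1 : ℕ)‖ : ℝ) ^ c * ‖Complex.GammaSeq w n‖ := by
    intro n hn
    have hn0 : (0 : ℝ) < n := by exact_mod_cast hn
    have hnorm : ∀ s : ℂ, ‖Complex.GammaSeq s n‖
        = (n : ℝ) ^ s.re * (Nat.factorial n : ℝ) / ∏ j ∈ Finset.range (n + 1), ‖s + j‖ := by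
      intro s
      rw [Complex.GammaSeq, norm_div, norm_mul, norm_prod, Complex.norm_natCast,
        Complex.norm_natCast_cpow_of_pos hn]
    rw [hnorm, hnorm]
    have hP : 0 < ∏ j ∈ Finset.range (n + 1), ‖w + j‖ := Finset.prod_pos fun j _ => hpos j
    have hQ : 0 < ∏ j ∈ Finset.range (n + 1), ‖w + c + j‖ := Finset.prod_pos fun j _ => hposc j
    have hle := prod_norm_le_prod_norm_add c hw h (n + 1)
    set P := ∏ j ∈ Finset.range (n + 1), ‖w + j‖
    set Q := ∏ j ∈ Finset.range (n + 1), ‖w + c + j‖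
    have hA' : exp ((c ^ 2 + |c|) * ∑ j ∈ Finset.range (n + 1), 1 / ((j : ℝ) ^ 2 + 1)) ≤ A := by
      rw [hA]
      gcongr
      exact summable_one_div_sq_add_one.sum_le_tsum _ fun j _ => by positivity
    have hle2 : P ≤ Q * A * (‖w‖ / ‖w + (n + 1 : ℕ)‖) ^ c := hle.trans (by gcongr)
    rw [Complex.add_re, Complex.ofReal_re, Real.rpow_add hn0, div_le_iff₀ hQ]
    have hd := (hpos (n + 1)).ne'
    rw [Real.div_rpow (by positivity) (by positivity)] at hle2 ⊢
    calc (n : ℝ) ^ w.re * (n : ℝ) ^ c * (Nat.factorial n : ℝ)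
        = (n : ℝ) ^ w.re * (n : ℝ) ^ c * (Nat.factorial n : ℝ) / P * P := by field_simp
      _ ≤ (n : ℝ) ^ w.re * (n : ℝ) ^ c * (Nat.factorial n : ℝ) / P *
          (Q * A * (‖w‖ ^ c / ‖w + (n + 1 : ℕ)‖ ^ c)) := by gcongr
      _ = _ := by ring
  have ht1 := (Complex.GammaSeq_tendsto_Gamma (w + c)).norm
  have ht2 := (hlim.const_mul (A * ‖w‖ ^ c)).mul (Complex.GammaSeq_tendsto_Gamma w).norm
  rw [mul_one] at ht2
  exact le_of_tendsto_of_tendsto ht1 ht2 (Filter.eventually_atTop.2 ⟨1, fun n hn => hseq n hn⟩)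

theorem norm_sin_le_exp_abs_im (z : ℂ) : ‖Complex.sin z‖ ≤ exp |z.im| := by
  have h1 : ‖Complex.exp (-z * Complex.I)‖ ≤ exp |z.im| := by
    rw [Complex.norm_exp]; gcongr; simpa using le_abs_self z.im
  have h2 : ‖Complex.exp (z * Complex.I)‖ ≤ exp |z.im| := by
    rw [Complex.norm_exp]; gcongr; simpa using neg_le_abs z.im
  rw [Complex.sin, norm_div, norm_mul, Complex.norm_I, mul_one, Complex.norm_two]
  have := norm_sub_le (Complex.exp (-z * Complex.I)) (Complex.exp (z * Complex.I))
  linarith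

theorem rpow_le_rpow_abs_mul_rpow {u v K : ℝ} (hu : 0 < u) (hv : 0 < v) (hK : 0 < K)
    (huv : u ≤ K * v) (hvu : v ≤ K * u) (c : ℝ) : u ^ c ≤ K ^ |c| * v ^ c := by
  rcases le_total 0 c with hc | hc
  · rw [abs_of_nonneg hc, ← Real.mul_rpow hK.le hv.le]
    exact Real.rpow_le_rpow hu.le huv hc
  · rw [abs_of_nonpos hc, Real.rpow_neg hK.le, ← Real.inv_rpow hK.le,
      ← Real.mul_rpow (by positivity) hv.le]
    refine Real.rpow_le_rpow_of_nonpos (by positivity) ?_ hc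
    rw [inv_mul_le_iff₀ hK]
    exact hvu

/-- The entire even function `1 / (Γ(α + w) Γ(α - w))`. -/
noncomputable def gammaRecip (α : ℝ) (w : ℂ) : ℂ :=
  (Complex.Gamma (α + w) * Complex.Gamma (α - w))⁻¹

theorem differentiable_gammaRecip (α : ℝ) : Differentiable ℂ (gammaRecip α) := by
  have h : gammaRecip α = fun w : ℂ =>
      (Complex.Gamma (α + w))⁻¹ * (Complex.Gamma (α - w))⁻¹ := by
    ext w; rw [gammaRecip, mul_inv]
  rw [h]
  exact (Complex.differentiable_one_div_Gamma.comp (by fun_prop : Differentiable ℂ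
    fun w : ℂ => (α : ℂ) + w)).mul (Complex.differentiable_one_div_Gamma.comp
    (by fun_prop : Differentiable ℂ fun w : ℂ => (α : ℂ) - w))

theorem gammaRecip_neg (α : ℝ) (w : ℂ) : gammaRecip α (-w) = gammaRecip α w := by
  rw [gammaRecip, gammaRecip, sub_neg_eq_add, ← sub_eq_add_neg, mul_comm]

theorem inv_norm_Gamma_le {s : ℂ} (hs : ∀ n : ℕ, s ≠ n + 1) :
    ‖Complex.Gamma s‖⁻¹ ≤ ‖Complex.Gamma (1 - s)‖ * ‖Complex.sin (π * s)‖ / π := by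
  by_cases h0 : Complex.Gamma s = 0
  · rw [h0, norm_zero, inv_zero]
    positivity
  have h1 : Complex.Gamma (1 - s) ≠ 0 := Complex.Gamma_ne_zero fun n hn => hs n (by
    linear_combination -hn)
  have h2 := Complex.Gamma_mul_Gamma_one_sub s
  have h3 : Complex.sin (π * s) ≠ 0 := fun h => by
    rw [h, div_zero] at h2
    exact mul_ne_zero h0 h1 h2
  have h4 : ‖Complex.Gamma s‖ * ‖Complex.Gamma (1 - s)‖ = π / ‖Complex.sin (π * s)‖ := by
    rw [← norm_mul, h2, norm_div, Complex.norm_real, Real.norm_eq_abs, abs_of_pos pi_pos]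
  have h0' := norm_pos_iff.2 h0
  have h3' := norm_pos_iff.2 h3
  rw [eq_div_iff h3'.ne'] at h4
  refine le_of_eq ?_
  rw [eq_div_iff pi_ne_zero, inv_mul_eq_iff_eq_mul₀ h0'.ne', ← mul_assoc, h4]

theorem norm_gammaRecip_le {α : ℝ} (hα : 0 < α) : ∃ C : ℝ, 0 ≤ C ∧ ∀ w : ℂ,
    ‖gammaRecip α w‖ ≤ C * (1 + ‖w‖) ^ (1 - 2 * α) * exp (π * |w.im|) := by
  set c := 1 - 2 * α with hc
  obtain ⟨A, hA, hΓ⟩ := norm_Gamma_add_le c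
  set R := 2 + 2 * |c| + α with hR
  have hc0 := abs_nonneg c
  have hcont : Continuous fun w : ℂ => ‖gammaRecip α w‖ * (1 + ‖w‖) ^ (-c) := by
    refine (differentiable_gammaRecip α).continuous.norm.mul ?_
    exact Continuous.rpow_const (by fun_prop) fun w => Or.inl (by positivity)
  obtain ⟨B, hB⟩ := (isCompact_closedBall (0 : ℂ) R).exists_bound_of_continuousOn
    hcont.continuousOn
  set K := 2 + α
  have hright : ∀ w : ℂ, 0 ≤ w.re → ‖gammaRecip α w‖
      ≤ (max B 0 + A * K ^ |c| / π) * (1 + ‖w‖) ^ c * exp (π * |w.im|) := by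
    intro w hw
    have he : 1 ≤ exp (π * |w.im|) := one_le_exp (by positivity)
    have hX : 0 < (1 + ‖w‖) ^ c := by positivity
    rcases le_or_gt ‖w‖ R with h | h
    · have h1 := hB w (by simpa using h)
      rw [Real.norm_eq_abs, abs_of_nonneg (by positivity), Real.rpow_neg (by positivity),
        ← div_eq_mul_inv, div_le_iff₀ hX] at h1
      calc ‖gammaRecip α w‖ ≤ B * (1 + ‖w‖) ^ c := h1
        _ ≤ (max B 0 + A * K ^ |c| / π) * (1 + ‖w‖) ^ c := by
            gcongr
            exact (le_max_left B 0).trans (le_add_of_nonneg_right (by positivity))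
        _ ≤ _ := le_mul_of_one_le_right (by positivity) he
    · have hs : ∀ n : ℕ, (α : ℂ) - w ≠ n + 1 := by
        intro n hn
        have hw2 : w = ((α - n - 1 : ℝ) : ℂ) := by push_cast; linear_combination -hn
        rw [hw2, Complex.ofReal_re] at hw
        rw [hw2, Complex.norm_real, Real.norm_eq_abs, abs_of_nonneg hw] at h
        have : (0 : ℝ) ≤ n := by positivity
        linarith
      have hn1 : ‖w‖ ≤ ‖(α : ℂ) + w‖ := by
        refine (sq_le_sq₀ (norm_nonneg _) (norm_nonneg _)).1 ?_
        rw [Complex.sq_norm, Complex.sq_norm, Complex.normSq_apply, Complex.normSq_apply]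
        simp only [Complex.add_re, Complex.ofReal_re, Complex.add_im, Complex.ofReal_im, zero_add]
        nlinarith [mul_nonneg hα.le hw, mul_pos hα hα]
      have hn2 : ‖(α : ℂ) + w‖ ≤ α + ‖w‖ := by
        have := norm_add_le (α : ℂ) w
        rwa [Complex.norm_real, Real.norm_eq_abs, abs_of_pos hα] at this
      have h1 := inv_norm_Gamma_le hs
      have h2 := hΓ (α + w) (by simp; linarith) (by linarith)
      rw [show (α : ℂ) + w + c = 1 - (α - w) by rw [hc]; push_cast; ring] at h2
      have h3 : ‖Complex.sin (π * (α - w))‖ ≤ exp (π * |w.im|) := by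
        refine (norm_sin_le_exp_abs_im _).trans (le_of_eq ?_)
        simp [abs_mul, abs_of_pos pi_pos]
      have h4 : ‖(α : ℂ) + w‖ ^ c ≤ K ^ |c| * (1 + ‖w‖) ^ c := by
        refine rpow_le_rpow_abs_mul_rpow (by linarith) (by positivity) (by positivity) ?_ ?_ c
        · nlinarith [norm_nonneg w]
        · nlinarith [norm_nonneg w]
      have hg : 0 < ‖Complex.Gamma (α + w)‖ := norm_pos_iff.2
        (Complex.Gamma_ne_zero_of_re_pos (by simp; linarith))
      rw [gammaRecip, norm_inv, norm_mul, mul_inv]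
      calc ‖Complex.Gamma (α + w)‖⁻¹ * ‖Complex.Gamma (α - w)‖⁻¹
          ≤ ‖Complex.Gamma (α + w)‖⁻¹ * ((A * (K ^ |c| * (1 + ‖w‖) ^ c) *
              ‖Complex.Gamma (α + w)‖) * exp (π * |w.im|) / π) := by
            gcongr
            refine h1.trans ?_
            gcongr
            refine h2.trans ?_
            gcongr
        _ = A * K ^ |c| / π * (1 + ‖w‖) ^ c * exp (π * |w.im|) := by
            field_simp
        _ ≤ _ := by
            gcongr
            exact le_add_of_nonneg_left (le_max_right _ _)
  refine ⟨max B 0 + A * K ^ |c| / π, by positivity, fun w => ?_⟩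
  rcases le_total 0 w.re with h | h
  · exact hright w h
  · have := hright (-w) (by simpa using h)
    rwa [gammaRecip_neg, norm_neg, Complex.neg_im, abs_neg] at this

theorem IsPaleyWiener.mollify {a : ℝ} {f : ℂ → ℂ} (ha : 0 ≤ a) (hf : IsPaleyWiener a f)
    {ε : ℝ} (h0 : 0 < ε) (h1 : ε ≤ 1) :
    IsPaleyWiener 2 fun z => f ((1 - ε : ℝ) * z) * gammaRecip (3 / 2) ((ε / π : ℝ) * z) := by
  obtain ⟨hd, C, hC, hb⟩ := hf
  obtain ⟨D, hD, hg⟩ := norm_gammaRecip_le (α := 3 / 2) (by norm_num)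
  refine ⟨(hd.comp (by fun_prop)).mul ((differentiable_gammaRecip _).comp (by fun_prop)),
    C * (D * (ε / π) ^ (-2 : ℝ)), by positivity, fun z => ?_⟩
  have hz := norm_nonneg z
  have hε : ε / π ≤ 1 := by
    rw [div_le_one pi_pos]
    linarith [pi_gt_three]
  have e1 : ‖f ((1 - ε : ℝ) * z)‖ ≤ C * exp ((1 - ε) * |z.im|) := by
    refine (hb _).trans ?_
    rw [Complex.im_ofReal_mul, abs_mul, abs_of_nonneg (sub_nonneg.2 h1)]
    gcongr
    refine mul_le_of_le_one_right hC (Real.rpow_le_one_of_one_le_of_nonpos ?_ (by linarith))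
    linarith [norm_nonneg (((1 - ε : ℝ) : ℂ) * z)]
  have e2 : ‖gammaRecip (3 / 2) ((ε / π : ℝ) * z)‖
      ≤ D * ((ε / π) ^ (-2 : ℝ) * (1 + ‖z‖) ^ (-2 : ℝ)) * exp (ε * |z.im|) := by
    refine (hg _).trans ?_
    rw [Complex.im_ofReal_mul, abs_mul, norm_mul, Complex.norm_real, Real.norm_eq_abs,
      abs_of_pos (by positivity : 0 < ε / π), 
      ← Real.mul_rpow (by positivity : 0 ≤ ε / π) (by positivity : 0 ≤ 1 + ‖z‖), ← mul_assoc π,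
      mul_div_cancel₀ _ pi_ne_zero, show (1 - 2 * (3 / 2) : ℝ) = -2 by norm_num]
    gcongr D * ?_ * _
    refine Real.rpow_le_rpow_of_nonpos (by positivity) ?_ (by norm_num)
    linarith
  rw [norm_mul]
  calc _ ≤ (C * exp ((1 - ε) * |z.im|)) *
        (D * ((ε / π) ^ (-2 : ℝ) * (1 + ‖z‖) ^ (-2 : ℝ)) * exp (ε * |z.im|)) := by gcongr
    _ = C * (D * (ε / π) ^ (-2 : ℝ)) * (1 + ‖z‖) ^ (-2 : ℝ) *
        (exp ((1 - ε) * |z.im|) * exp (ε * |z.im|)) := by ring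
    _ = _ := by rw [← exp_add]; ring_nf

theorem gammaRecip_zero_ne_zero {α : ℝ} (hα : 0 < α) : gammaRecip α 0 ≠ 0 := by
  have := Complex.Gamma_ne_zero_of_re_pos (s := α) (by simpa using hα)
  rw [gammaRecip, add_zero, sub_zero]
  exact inv_ne_zero (mul_ne_zero this this)

theorem IsPaleyWiener.integral_besselJ_zero_mul {a : ℝ} {f : ℂ → ℂ} (ha : 1 / 2 < a)
    (hf : IsPaleyWiener a f) (hodd : ∀ z, f (-z) = -f z) :
    ∫ x in Set.Ioi (0 : ℝ), (besselJ 0 x : ℂ) * f x = 0 := by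
  set ε : ℕ → ℝ := fun n => 1 / ((n : ℝ) + 2) with hεdef
  have hε0 : ∀ n, 0 < ε n := fun n => by positivity
  have hε1 : ∀ n, ε n ≤ 1 / 2 := fun n => by
    simp only [hεdef]; gcongr; linarith [(Nat.cast_nonneg n : (0 : ℝ) ≤ n)]
  have hεlim : Filter.Tendsto ε Filter.atTop (nhds 0) := by
    refine tendsto_const_nhds.div_atTop ?_
    exact Filter.tendsto_atTop_add_const_right _ _ tendsto_natCast_atTop_atTop
  set F : ℕ → ℝ → ℂ := fun n x => (besselJ 0 x : ℂ) *
    (f ((1 - ε n : ℝ) * x) * gammaRecip (3 / 2) ((ε n / π : ℝ) * x)) with hF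
  have hmol : ∀ n, IsPaleyWiener 2 fun z =>
      f ((1 - ε n : ℝ) * z) * gammaRecip (3 / 2) ((ε n / π : ℝ) * z) := fun n =>
    hf.mollify (by linarith) (hε0 n) (by linarith [hε1 n])
  have hzero : ∀ n, ∫ x in Set.Ioi (0 : ℝ), F n x = 0 := fun n =>
    (hmol n).integral_besselJ_zero_mul_of_two fun z => by
      simp only [mul_neg, hodd, gammaRecip_neg, neg_mul]
  obtain ⟨D, hD, hg⟩ := norm_gammaRecip_le (α := 3 / 2) (by norm_num)
  obtain ⟨C, hC, hb⟩ := hf.norm_ofReal_le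
  obtain ⟨B, hB, hJ⟩ := abs_besselJ_le 0
  have hlim : Filter.Tendsto (fun n => ∫ x in Set.Ioi (0 : ℝ), F n x) Filter.atTop
      (nhds (∫ x in Set.Ioi (0 : ℝ), (besselJ 0 x : ℂ) * f x * gammaRecip (3 / 2) 0)) := by
    refine tendsto_integral_of_dominated_convergence
      (fun x => B * C * 2 ^ |-a| * D * (1 + x) ^ (-(1 / 2 + a))) (fun n => ?_) ?_ (fun n => ?_) ?_
    · exact (continuous_besselJ_mul (hmol n).1.continuous 0).aestronglyMeasurable
    · exact (integrableOn_one_add_rpow (by linarith)).const_mul _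
    · refine (ae_restrict_iff' measurableSet_Ioi).2 (Filter.Eventually.of_forall fun x hx => ?_)
      have hx0 : 0 < x := hx
      have h1 : ‖gammaRecip (3 / 2) ((ε n / π : ℝ) * x)‖ ≤ D := by
        have := hg ((ε n / π * x : ℝ) : ℂ)
        rw [Complex.ofReal_im, abs_zero, mul_zero, exp_zero, mul_one] at this
        rw [← Complex.ofReal_mul]
        refine this.trans (mul_le_of_le_one_right hD
          (Real.rpow_le_one_of_one_le_of_nonpos ?_ (by norm_num)))
        linarith [norm_nonneg ((ε n / π * x : ℝ) : ℂ)]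
      have h2 : ‖f ((1 - ε n : ℝ) * x)‖ ≤ C * (2 ^ |-a| * (1 + x) ^ (-a)) := by
        have hpos : 0 ≤ (1 - ε n) * x := mul_nonneg (by linarith [hε1 n]) hx0.le
        rw [← Complex.ofReal_mul]
        refine (hb _ hpos).trans ?_
        gcongr
        refine rpow_le_rpow_abs_mul_rpow (by positivity) (by positivity) (by norm_num) ?_ ?_ _
        · nlinarith [hε0 n]
        · nlinarith [hε1 n]
      simp only [hF]
      rw [norm_mul, norm_mul, Complex.norm_real, Real.norm_eq_abs]
      calc _ ≤ (B * (1 + x) ^ (-(1 / 2) : ℝ)) * (C * (2 ^ |-a| * (1 + x) ^ (-a)) * D) := by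
            gcongr
            exact hJ x hx0.le
        _ = B * C * 2 ^ |-a| * D * ((1 + x) ^ (-(1 / 2) : ℝ) * (1 + x) ^ (-a)) := by ring
        _ = _ := by rw [← Real.rpow_add (by positivity)]; ring_nf
    · refine Filter.Eventually.of_forall fun x => ?_
      have h1 : Filter.Tendsto (fun n => ((1 - ε n : ℝ) : ℂ) * x) Filter.atTop (nhds (x : ℂ)) := by
        have := (Complex.continuous_ofReal.tendsto _).comp (hεlim.const_sub 1)
        simpa using this.mul_const (x : ℂ)
      have h2 : Filter.Tendsto (fun n => ((ε n / π : ℝ) : ℂ) * x) Filter.atTop (nhds 0) := by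
        have := (Complex.continuous_ofReal.tendsto _).comp (hεlim.div_const π)
        simpa using this.mul_const (x : ℂ)
      simp only [hF, mul_assoc]
      exact (((hf.1.continuous.tendsto _).comp h1).mul
        (((differentiable_gammaRecip _).continuous.tendsto _).comp h2)).const_mul _
  simp only [hzero] at hlim
  have h := tendsto_nhds_unique hlim tendsto_const_nhds
  rw [integral_mul_const] at h
  exact (mul_eq_zero.1 h).resolve_right (gammaRecip_zero_ne_zero (by norm_num))

theorem IsPaleyWiener.tendsto_besselJ_mul {a : ℝ} {f : ℂ → ℂ} (ha : 1 / 2 < a)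
    (hf : IsPaleyWiener a f) (n : ℕ) :
    Filter.Tendsto (fun x : ℝ => (besselJ n x : ℂ) * f x) Filter.atTop (nhds 0) := by
  obtain ⟨C, hC⟩ := hf.norm_besselJ_mul_le n
  refine squeeze_zero_norm' (Filter.eventually_atTop.2 ⟨0, fun x hx => hC x hx⟩) ?_
  simpa using ((tendsto_rpow_neg_atTop (by linarith : 0 < a + 1 / 2)).comp
    (Filter.tendsto_atTop_add_const_left _ 1 Filter.tendsto_id)).const_mul C

theorem IsPaleyWiener.integral_besselJ_one_mul {a : ℝ} {f : ℂ → ℂ} (ha : 1 / 2 < a)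
    (hf : IsPaleyWiener a f) :
    ∫ x in Set.Ioi (0 : ℝ), (besselJ 1 x : ℂ) * f x
      = f 0 + ∫ x in Set.Ioi (0 : ℝ), (besselJ 0 x : ℂ) * _root_.deriv f x := by
  have hf' := hf.deriv (by linarith)
  have h0 := hf'.integrableOn_besselJ_mul ha 0
  have h1 := hf.integrableOn_besselJ_mul ha 1
  have h := integral_Ioi_of_hasDerivAt_of_tendsto' (a := 0)
    (f := fun x : ℝ => (besselJ 0 x : ℂ) * f x)
    (f' := fun x : ℝ => (besselJ 0 x : ℂ) * _root_.deriv f x - (besselJ 1 x : ℂ) * f x)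
    (fun x _ => ((hasDerivAt_besselJ_zero x).ofReal_comp.mul
      (hf.1 x).hasDerivAt.comp_ofReal).congr_deriv (by push_cast; ring))
    (h0.sub h1) (hf.tendsto_besselJ_mul ha 0)
  rw [integral_sub h0 h1, besselJ_zero_zero] at h
  push_cast at h
  linear_combination -h

theorem IsPaleyWiener.integral_besselJ_add_two_mul {a : ℝ} {f : ℂ → ℂ} (ha : 1 / 2 < a)
    (hf : IsPaleyWiener a f) (n : ℕ) :
    ∫ x in Set.Ioi (0 : ℝ), (besselJ (n + 2) x : ℂ) * f x
      = (∫ x in Set.Ioi (0 : ℝ), (besselJ n x : ℂ) * f x)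
        + 2 * ∫ x in Set.Ioi (0 : ℝ), (besselJ (n + 1) x : ℂ) * _root_.deriv f x := by
  have hf' := hf.deriv (by linarith)
  have h0 := hf.integrableOn_besselJ_mul ha n
  have h1 := (hf'.integrableOn_besselJ_mul ha (n + 1)).const_mul 2
  have h01 : IntegrableOn (fun x : ℝ => (besselJ n x : ℂ) * f x +
      2 * ((besselJ (n + 1) x : ℂ) * _root_.deriv f x)) (Set.Ioi 0) := h0.add h1
  have h2 := hf.integrableOn_besselJ_mul ha (n + 2)
  have h := integral_Ioi_of_hasDerivAt_of_tendsto' (a := 0)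
    (f := fun x : ℝ => 2 * ((besselJ (n + 1) x : ℂ) * f x))
    (f' := fun x : ℝ => (besselJ n x : ℂ) * f x + 2 * ((besselJ (n + 1) x : ℂ) * _root_.deriv f x)
      - (besselJ (n + 2) x : ℂ) * f x)
    (fun x _ => (((hasDerivAt_besselJ_succ n x).ofReal_comp.mul
      (hf.1 x).hasDerivAt.comp_ofReal).const_mul 2).congr_deriv (by push_cast; ring))
    (h01.sub h2) ((hf.tendsto_besselJ_mul ha (n + 1)).const_mul 2)
  rw [integral_sub h01 h2, integral_add h0 h1, besselJ_succ_zero,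
    integral_const_mul] at h
  push_cast at h
  linear_combination -h

theorem deriv_even_of_odd {f : ℂ → ℂ} (hf : ∀ z, f (-z) = -f z) (z : ℂ) :
    deriv f (-z) = deriv f z := by
  have h : (fun z => f (-z)) = fun z => -f z := funext hf
  have h2 := congrArg (fun g => deriv g z) h
  simp only [deriv_comp_neg, deriv.fun_neg] at h2
  exact neg_injective h2

theorem deriv_odd_of_even {f : ℂ → ℂ} (hf : ∀ z, f (-z) = f z) (z : ℂ) :
    deriv f (-z) = -deriv f z := by
  have h : (fun z => f (-z)) = f := funext hf
  have h2 := congrArg (fun g => deriv g z) h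
  simp only [deriv_comp_neg] at h2
  rw [← h2, neg_neg]

theorem IsPaleyWiener.integral_besselJ_mul_aux {a : ℝ} (ha : 1 / 2 < a) (k : ℕ) :
    (∀ f : ℂ → ℂ, IsPaleyWiener a f → (∀ z, f (-z) = -f z) →
      ∫ x in Set.Ioi (0 : ℝ), (besselJ (2 * k) x : ℂ) * f x
        = ∑ i ∈ Finset.range k,
          (2 : ℂ) ^ (2 * i + 1) * ((k + i).choose (2 * i + 1) : ℂ) * iteratedDeriv (2 * i + 1) f 0) ∧
    (∀ f : ℂ → ℂ, IsPaleyWiener a f → (∀ z, f (-z) = f z) →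
      ∫ x in Set.Ioi (0 : ℝ), (besselJ (2 * k + 1) x : ℂ) * f x
        = ∑ i ∈ Finset.range (k + 1),
          (2 : ℂ) ^ (2 * i) * ((k + i).choose (2 * i) : ℂ) * iteratedDeriv (2 * i) f 0) := by
  induction k with
  | zero =>
    refine ⟨fun f hf hodd => ?_, fun f hf heven => ?_⟩
    · simpa using hf.integral_besselJ_zero_mul ha hodd
    · have h := hf.integral_besselJ_one_mul ha
      rw [(hf.deriv (by linarith)).integral_besselJ_zero_mul ha (deriv_odd_of_even heven)] at h
      simpa using h
  | succ k ih =>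
    obtain ⟨ih0, ih1⟩ := ih
    have hodd_step : ∀ f : ℂ → ℂ, IsPaleyWiener a f → (∀ z, f (-z) = -f z) →
        ∫ x in Set.Ioi (0 : ℝ), (besselJ (2 * (k + 1)) x : ℂ) * f x
          = ∑ i ∈ Finset.range (k + 1), (2 : ℂ) ^ (2 * i + 1) *
            ((k + 1 + i).choose (2 * i + 1) : ℂ) * iteratedDeriv (2 * i + 1) f 0 := by
      intro f hf hodd
      rw [show 2 * (k + 1) = 2 * k + 2 by ring, hf.integral_besselJ_add_two_mul ha,
        ih0 f hf hodd, ih1 _ (hf.deriv (by linarith)) (deriv_even_of_odd hodd)]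
      have h1 : ∑ i ∈ Finset.range k, (2 : ℂ) ^ (2 * i + 1) * ((k + i).choose (2 * i + 1) : ℂ) *
          iteratedDeriv (2 * i + 1) f 0 = ∑ i ∈ Finset.range (k + 1), (2 : ℂ) ^ (2 * i + 1) *
            ((k + i).choose (2 * i + 1) : ℂ) * iteratedDeriv (2 * i + 1) f 0 := by
        rw [Finset.sum_range_succ, Nat.choose_eq_zero_of_lt (by omega : k + k < 2 * k + 1)]
        simp
      rw [h1, Finset.mul_sum, ← Finset.sum_add_distrib]
      refine Finset.sum_congr rfl fun i _ => ?_
      rw [← iteratedDeriv_succ', show k + 1 + i = k + i + 1 by ring, Nat.choose_succ_succ']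
      push_cast
      ring
    refine ⟨hodd_step, fun f hf heven => ?_⟩
    rw [show 2 * (k + 1) + 1 = 2 * k + 1 + 2 by ring, hf.integral_besselJ_add_two_mul ha,
      show 2 * k + 1 + 1 = 2 * (k + 1) by ring, ih1 f hf heven,
      hodd_step _ (hf.deriv (by linarith)) (deriv_odd_of_even heven)]
    have h1 : ∑ i ∈ Finset.range (k + 1), (2 : ℂ) ^ (2 * i) * ((k + i).choose (2 * i) : ℂ) *
        iteratedDeriv (2 * i) f 0 = ∑ i ∈ Finset.range (k + 1 + 1), (2 : ℂ) ^ (2 * i) *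
          ((k + i).choose (2 * i) : ℂ) * iteratedDeriv (2 * i) f 0 := by
      rw [Finset.sum_range_succ _ (k + 1),
        Nat.choose_eq_zero_of_lt (by omega : k + (k + 1) < 2 * (k + 1))]
      simp
    rw [h1, Finset.sum_range_succ', Finset.sum_range_succ' _ (k + 1), Finset.mul_sum,
      add_right_comm, ← Finset.sum_add_distrib]
    congr 1
    · refine Finset.sum_congr rfl fun i _ => ?_
      rw [← iteratedDeriv_succ', show k + 1 + (i + 1) = k + 1 + i + 1 by ring,
        show 2 * (i + 1) = 2 * i + 1 + 1 by ring, Nat.choose_succ_succ' (k + 1 + i),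
        show k + (i + 1) = k + 1 + i by ring]
      push_cast
      ring
    · simp

/-- Integrals of odd functions of exponential type one against even-order Bessel functions. -/
theorem IsPaleyWiener.integral_besselJ_two_mul {a : ℝ} {f : ℂ → ℂ} (ha : 1 / 2 < a)
    (hf : IsPaleyWiener a f) (hodd : ∀ z, f (-z) = -f z) (k : ℕ) :
    ∫ x in Set.Ioi (0 : ℝ), (besselJ (2 * k) x : ℂ) * f x
      = ∑ i ∈ Finset.range k,
        (2 : ℂ) ^ (2 * i + 1) * ((k + i).choose (2 * i + 1) : ℂ) * iteratedDeriv (2 * i + 1) f 0 :=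
  (IsPaleyWiener.integral_besselJ_mul_aux ha k).1 f hf hodd

theorem iteratedDeriv_ofReal_eq {G : ℂ → ℂ} {g : ℝ → ℝ} (hG : Differentiable ℂ G)
    (h : ∀ x : ℝ, G x = g x) (n : ℕ) (x : ℝ) :
    iteratedDeriv n G x = (iteratedDeriv n g x : ℝ) := by
  induction n generalizing G g with
  | zero => simpa using h x
  | succ n ih =>
    rw [iteratedDeriv_succ', iteratedDeriv_succ']
    refine ih (fun z => (hG.analyticAt z).deriv.differentiableAt) fun y => ?_
    have h1 : HasDerivAt g (deriv G y).re y := by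
      simpa [h] using (hG y).hasDerivAt.real_of_complex
    have h2 : HasDerivAt (fun t : ℝ => (g t : ℂ)) (deriv G y) y := by
      simpa [h] using (hG y).hasDerivAt.comp_ofReal
    rw [h1.deriv]
    exact h2.unique h1.ofReal_comp

theorem iteratedDeriv_succ_id_mul_zero {h : ℂ → ℂ} (hh : Differentiable ℂ h) (n : ℕ) :
    iteratedDeriv (n + 1) (fun z => z * h z) 0 = (n + 1) * iteratedDeriv n h 0 := by
  have hd : ∀ g : ℂ → ℂ, Differentiable ℂ g →
      deriv (fun z => z * g z) = fun z => g z + z * deriv g z := fun g hg => by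
    ext z
    simpa using ((hasDerivAt_id' z).fun_mul (hg z).hasDerivAt).deriv
  induction n generalizing h with
  | zero => simp [hd h hh]
  | succ n ih =>
    have hh' : Differentiable ℂ (deriv h) := fun z => (hh.analyticAt z).deriv.differentiableAt
    rw [iteratedDeriv_succ', hd h hh, iteratedDeriv_fun_add hh.contDiff.contDiffAt
      (differentiable_fun_id.fun_mul hh').contDiff.contDiffAt, ih hh', ← iteratedDeriv_succ']
    push_cast
    ring

theorem iteratedDeriv_pow_mul_zero {h : ℂ → ℂ} (hh : Differentiable ℂ h) (p n : ℕ) :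
    iteratedDeriv n (fun z => z ^ p * h z) 0
      = (n.descFactorial p : ℂ) * iteratedDeriv (n - p) h 0 := by
  induction p generalizing n with
  | zero => simp
  | succ p ih =>
    cases n with
    | zero => simp
    | succ n =>
      have h1 : (fun z => z ^ (p + 1) * h z) = fun z => z * (z ^ p * h z) := by
        ext z; ring
      rw [h1, iteratedDeriv_succ_id_mul_zero (by fun_prop), ih, Nat.succ_descFactorial_succ,
        Nat.add_sub_add_right]
      push_cast
      ring

/-- The extension of `gammaProd` to the complex plane. -/
noncomputable def gammaProdComplex (M : ℕ) (α β : ℕ → ℝ) (z : ℂ) : ℂ :=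
  ∏ k ∈ Finset.range M, gammaRecip (α k) (β k * z)

theorem gammaProdComplex_ofReal (M : ℕ) (α β : ℕ → ℝ) (x : ℝ) :
    gammaProdComplex M α β x = (gammaProd M α β x : ℝ) := by
  simp [gammaProdComplex, gammaProd, gammaRecip, Complex.ofReal_prod, ← Complex.Gamma_ofReal]

theorem gammaProdComplex_neg (M : ℕ) (α β : ℕ → ℝ) (z : ℂ) :
    gammaProdComplex M α β (-z) = gammaProdComplex M α β z := by
  simp [gammaProdComplex, gammaRecip_neg]

theorem differentiable_gammaProdComplex (M : ℕ) (α β : ℕ → ℝ) :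
    Differentiable ℂ (gammaProdComplex M α β) := by
  unfold gammaProdComplex
  exact Differentiable.fun_finsetProd fun k _ =>
    (differentiable_gammaRecip (α k)).comp (by fun_prop)

theorem one_add_mul_rpow_le {b : ℝ} (hb : 0 < b) (c : ℝ) {x : ℝ} (hx : 0 ≤ x) :
    (1 + b * x) ^ c ≤ (1 + b + b⁻¹) ^ |c| * (1 + x) ^ c := by
  have hi : 0 < b⁻¹ := inv_pos.2 hb
  have h1 : b⁻¹ * b = 1 := inv_mul_cancel₀ hb.ne'
  refine rpow_le_rpow_abs_mul_rpow (by positivity) (by positivity) (by positivity) ?_ ?_ c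
  · nlinarith [mul_nonneg hi.le hx]
  · have : b⁻¹ * (b * x) = x := inv_mul_cancel_left₀ hb.ne' x
    nlinarith [mul_nonneg hb.le hx, mul_nonneg hb.le (mul_nonneg hb.le hx)]

theorem norm_gammaProdComplex_le {M : ℕ} {α β : ℕ → ℝ} (hα : ∀ k ∈ Finset.range M, 0 < α k)
    (hβ : ∀ k ∈ Finset.range M, 0 < β k) : ∃ C : ℝ, 0 ≤ C ∧ ∀ z : ℂ,
      ‖gammaProdComplex M α β z‖ ≤ C * (1 + ‖z‖) ^ ((M : ℝ) - 2 * ∑ k ∈ Finset.range M, α k) *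
        exp (π * (∑ k ∈ Finset.range M, β k) * |z.im|) := by
  induction M with
  | zero => exact ⟨1, zero_le_one, fun z => by simp [gammaProdComplex]⟩
  | succ M ih =>
    obtain ⟨C, hC, hb⟩ := ih (fun k hk => hα k (Finset.mem_range.2
      ((Finset.mem_range.1 hk).trans M.lt_succ_self))) (fun k hk => hβ k (Finset.mem_range.2
      ((Finset.mem_range.1 hk).trans M.lt_succ_self)))
    have hαM := hα M (Finset.self_mem_range_succ M)
    have hβM := hβ M (Finset.self_mem_range_succ M)
    obtain ⟨D, hD, hg⟩ := norm_gammaRecip_le hαM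
    set c := 1 - 2 * α M with hc
    refine ⟨C * (D * (1 + β M + (β M)⁻¹) ^ |c|), by positivity, fun z => ?_⟩
    have h1 : ‖gammaRecip (α M) (β M * z)‖ ≤ D * ((1 + β M + (β M)⁻¹) ^ |c| * (1 + ‖z‖) ^ c) *
        exp (π * β M * |z.im|) := by
      refine (hg _).trans ?_
      rw [Complex.im_ofReal_mul, abs_mul, norm_mul, Complex.norm_real, Real.norm_eq_abs,
        abs_of_pos hβM, ← mul_assoc π]
      gcongr D * ?_ * _
      exact one_add_mul_rpow_le hβM c (norm_nonneg z)
    have h2 : gammaProdComplex (M + 1) α β z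
        = gammaProdComplex M α β z * gammaRecip (α M) (β M * z) := Finset.prod_range_succ _ _
    rw [h2, norm_mul, Finset.sum_range_succ, Finset.sum_range_succ]
    refine (mul_le_mul (hb z) h1 (norm_nonneg _) (by positivity)).trans (le_of_eq ?_)
    rw [show ((M + 1 : ℕ) : ℝ) - 2 * (∑ k ∈ Finset.range M, α k + α M)
        = ((M : ℝ) - 2 * ∑ k ∈ Finset.range M, α k) + c by push_cast; ring,
      Real.rpow_add (by positivity), mul_add, add_mul, exp_add]
    ring

theorem isPaleyWiener_pow_mul_gammaProdComplex {M : ℕ} {α β : ℕ → ℝ}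
    (hα : ∀ k ∈ Finset.range M, 0 < α k) (hβ : ∀ k ∈ Finset.range M, 0 < β k) (p : ℕ) {lam : ℝ}
    (hlam0 : 0 < lam) (hlam : π * ∑ k ∈ Finset.range M, β k ≤ lam) :
    IsPaleyWiener (2 * ∑ k ∈ Finset.range M, α k - M - p) fun z =>
      ((lam⁻¹ : ℝ) * z : ℂ) ^ p * gammaProdComplex M α β ((lam⁻¹ : ℝ) * z) := by
  obtain ⟨C, hC, hb⟩ := norm_gammaProdComplex_le hα hβ
  set a := 2 * ∑ k ∈ Finset.range M, α k - M - p with ha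
  have hi : 0 < lam⁻¹ := inv_pos.2 hlam0
  refine ⟨Differentiable.mul (by fun_prop)
    ((differentiable_gammaProdComplex M α β).comp (by fun_prop)),
    C * (1 + lam⁻¹ + lam⁻¹⁻¹) ^ |-a|, by positivity, fun z => ?_⟩
  have h1 := hb ((lam⁻¹ : ℝ) * z)
  have hn : ‖((lam⁻¹ : ℝ) * z : ℂ)‖ = lam⁻¹ * ‖z‖ := by
    rw [norm_mul, Complex.norm_real, Real.norm_eq_abs, abs_of_pos hi]
  rw [Complex.im_ofReal_mul, abs_mul, abs_of_pos hi, hn] at h1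
  have h2 : exp (π * (∑ k ∈ Finset.range M, β k) * (lam⁻¹ * |z.im|)) ≤ exp |z.im| := by
    gcongr
    rw [← mul_assoc]
    refine mul_le_of_le_one_left (abs_nonneg _) ?_
    rwa [← div_eq_mul_inv, div_le_one hlam0]
  have h3 : (lam⁻¹ * ‖z‖) ^ p ≤ (1 + lam⁻¹ * ‖z‖) ^ (p : ℝ) := by
    rw [Real.rpow_natCast]
    gcongr
    linarith
  rw [norm_mul, norm_pow, hn]
  calc _ ≤ (1 + lam⁻¹ * ‖z‖) ^ (p : ℝ) * (C * (1 + lam⁻¹ * ‖z‖) ^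
        ((M : ℝ) - 2 * ∑ k ∈ Finset.range M, α k) * exp |z.im|) := by
        refine mul_le_mul h3 (h1.trans ?_) (norm_nonneg _) (by positivity)
        gcongr
    _ = C * (1 + lam⁻¹ * ‖z‖) ^ (-a) * exp |z.im| := by
        rw [show -a = p + ((M : ℝ) - 2 * ∑ k ∈ Finset.range M, α k) by rw [ha]; ring,
          Real.rpow_add (by positivity)]
        ring
    _ ≤ C * ((1 + lam⁻¹ + lam⁻¹⁻¹) ^ |-a| * (1 + ‖z‖) ^ (-a)) * exp |z.im| := by
        gcongr C * ?_ * _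
        exact one_add_mul_rpow_le hi _ (norm_nonneg z)
    _ = _ := by ring

theorem choose_mul_descFactorial (m s q : ℕ) :
    (((2 * (m + s) + 1 + q).choose (2 * (m + s) + 1) : ℝ) *
      ((2 * (m + s) + 1).descFactorial (2 * m + 1) : ℝ))
      = (Nat.factorial (2 * (m + s) + 1 + q) : ℝ) /
        ((Nat.factorial (2 * s) : ℝ) * (Nat.factorial q : ℝ)) := by
  have h1 := Nat.add_choose_mul_factorial_mul_factorial (2 * (m + s) + 1) q
  have h2 := Nat.factorial_mul_descFactorial (show 2 * m + 1 ≤ 2 * (m + s) + 1 by omega)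
  rw [show 2 * (m + s) + 1 - (2 * m + 1) = 2 * s by omega] at h2
  rw [← Nat.choose_symm_add] at h1
  rw [eq_div_iff (by positivity), ← h1, ← h2]
  push_cast
  ring

theorem hankel_gamma_terminating_even_order
    (M : ℕ) (hM : 1 ≤ M) (α β : ℕ → ℝ)
    (hα : ∀ k ∈ Finset.range M, 0 < α k) (hβ : ∀ k ∈ Finset.range M, 0 < β k)
    (m l : ℕ) (hl : m + 1 ≤ l)
    (hαsum : (m : ℝ) + (1 / 2) * ((M : ℝ) + 3 / 2) < ∑ k ∈ Finset.range M, α k)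
    (lam : ℝ) (hlam : π * ∑ k ∈ Finset.range M, β k ≤ lam) :
    ∫ x in Set.Ioi (0 : ℝ), x ^ (2 * m + 1) * besselJ (2 * l) (lam * x) * gammaProd M α β x
      = (1 / 2) * ∑ s ∈ Finset.range (l - m),
          (iteratedDeriv (2 * s) (gammaProd M α β) 0 / (Nat.factorial (2 * s) : ℝ))
            * ((Nat.factorial (l + m + s) : ℝ) / (Nat.factorial (l - m - s - 1) : ℝ))
            * (2 / lam) ^ (2 * (m + s + 1)) := by
  have hlam0 : 0 < lam := lt_of_lt_of_le
    (mul_pos pi_pos (Finset.sum_pos hβ (Finset.nonempty_range_iff.2 (by omega)))) hlam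
  have hGd := differentiable_gammaProdComplex M α β
  have hF := isPaleyWiener_pow_mul_gammaProdComplex hα hβ (2 * m + 1) hlam0 hlam
  have hmain := hF.integral_besselJ_two_mul (by push_cast; linarith)
    (fun z => by
      rw [mul_neg, gammaProdComplex_neg, Odd.neg_pow ⟨m, rfl⟩, neg_mul]) l
  have hderiv : ∀ n, iteratedDeriv n (fun z : ℂ => ((lam⁻¹ : ℝ) * z : ℂ) ^ (2 * m + 1) *
      gammaProdComplex M α β ((lam⁻¹ : ℝ) * z)) 0 = (((lam⁻¹) ^ n * ((n.descFactorial (2 * m + 1) *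
        iteratedDeriv (n - (2 * m + 1)) (gammaProd M α β) 0)) : ℝ) : ℂ) := by
    intro n
    have hH : Differentiable ℂ fun z : ℂ => z ^ (2 * m + 1) * gammaProdComplex M α β z := by
      fun_prop
    have h1 := congrFun (iteratedDeriv_comp_const_mul (n := n) hH.contDiff ((lam⁻¹ : ℝ) : ℂ)) 0
    rw [h1, mul_zero, iteratedDeriv_pow_mul_zero hGd, ← Complex.ofReal_zero,
      iteratedDeriv_ofReal_eq hGd (gammaProdComplex_ofReal M α β)]
    push_cast
    ring
  have hcast : ∀ x : ℝ, (besselJ (2 * l) x : ℂ) * (((lam⁻¹ : ℝ) * x : ℂ) ^ (2 * m + 1) *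
      gammaProdComplex M α β ((lam⁻¹ : ℝ) * x)) = ((besselJ (2 * l) x * ((lam⁻¹ * x) ^ (2 * m + 1) *
        gammaProd M α β (lam⁻¹ * x)) : ℝ) : ℂ) := by
    intro x
    rw [← Complex.ofReal_mul, gammaProdComplex_ofReal]
    push_cast
    ring
  simp only [hderiv, hcast] at hmain
  rw [integral_complex_ofReal] at hmain
  have hreal : ∫ x in Set.Ioi (0 : ℝ), besselJ (2 * l) x * ((lam⁻¹ * x) ^ (2 * m + 1) *
      gammaProd M α β (lam⁻¹ * x)) = ∑ i ∈ Finset.range l, 2 ^ (2 * i + 1) *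
        ((l + i).choose (2 * i + 1) : ℝ) * (lam⁻¹ ^ (2 * i + 1) *
          ((2 * i + 1).descFactorial (2 * m + 1) *
            iteratedDeriv (2 * i + 1 - (2 * m + 1)) (gammaProd M α β) 0)) := by
    exact_mod_cast hmain
  have hsub := integral_comp_mul_left_Ioi (fun x : ℝ => besselJ (2 * l) x *
    ((lam⁻¹ * x) ^ (2 * m + 1) * gammaProd M α β (lam⁻¹ * x))) 0 hlam0
  simp only [inv_mul_cancel_left₀ hlam0.ne', mul_zero, smul_eq_mul] at hsub
  rw [hreal] at hsub
  have hcomm : ∀ x : ℝ, x ^ (2 * m + 1) * besselJ (2 * l) (lam * x) * gammaProd M α β x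
      = besselJ (2 * l) (lam * x) * (x ^ (2 * m + 1) * gammaProd M α β x) := fun x => by ring
  simp only [hcomm]
  obtain ⟨d, rfl⟩ := Nat.exists_eq_add_of_le (Nat.le_of_succ_le hl)
  rw [hsub, Finset.sum_range_add, Finset.sum_eq_zero, zero_add, Nat.add_sub_cancel_left,
    Finset.mul_sum, Finset.mul_sum]
  · refine Finset.sum_congr rfl fun s hs => ?_
    obtain ⟨q, rfl⟩ := Nat.exists_eq_add_of_lt (Finset.mem_range.1 hs)
    have h1 := choose_mul_descFactorial m s q
    rw [show m + (s + q + 1) + (m + s) = 2 * (m + s) + 1 + q by ring,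
      show 2 * (m + s) + 1 - (2 * m + 1) = 2 * s by omega,
      show m + (s + q + 1) + m + s = 2 * (m + s) + 1 + q by ring,
      show s + q + 1 - s - 1 = q by omega]
    calc _ = lam⁻¹ * (2 ^ (2 * (m + s) + 1) * lam⁻¹ ^ (2 * (m + s) + 1) *
          iteratedDeriv (2 * s) (gammaProd M α β) 0) * (((2 * (m + s) + 1 + q).choose
            (2 * (m + s) + 1) : ℝ) * ((2 * (m + s) + 1).descFactorial (2 * m + 1) : ℝ)) := by ring
      _ = _ := by
        rw [h1]
        ring
  · intro i hi
    rw [Nat.descFactorial_of_lt (by have := Finset.mem_range.1 hi; omega)]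
    simp
end
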